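/- arXiv:1005.0422 — 3 statements merged into one kernel-verified Lean document; each statement's English description precedes it below -/
import Mathlib

section
/- Let $A$ be an algebraic ring over an algebraically closed field $K$ (of any characteristic). Then $A$ decomposes as a direct sum of two-sided ideals $A = A' \oplus C$, where $A'$ consists of all elements of the additive group $(A,\alpha)$ that are unipotent, and $C$ is a finite ring consisting of all semisimple elements. In particular, if $A$ is connected, then every element of the additive group of $A$ is unipotent. -/
noncomputable section

open MvPolynomial

/-- The Zariski topology on affine `n`-space over `K`. -/
def affineZariski (K : Type) [Field K] (n : ℕ) : TopologicalSpace (Fin n → K) :=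
  TopologicalSpace.generateFrom
    {U | ∃ p : MvPolynomial (Fin n) K, U = {x | MvPolynomial.eval x p ≠ 0}}

/-- An algebraic ring over `K`: a Zariski-closed subset of some affine space `K^n`
equipped with regular (polynomial) addition, negation and multiplication maps making it
into a unital ring whose additive group is a commutative algebraic group. -/
structure AlgebraicRing (K : Type) [Field K] where
  n : ℕ
  carrier : Set (Fin n → K)
  carrier_closed : ∃ S : Set (MvPolynomial (Fin n) K),
    carrier = {x | ∀ p ∈ S, MvPolynomial.eval x p = 0}
  add : (Fin n → K) → (Fin n → K) → Fin n → K
  mul : (Fin n → K) → (Fin n → K) → Fin n → K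
  neg : (Fin n → K) → Fin n → K
  zero : Fin n → K
  one : Fin n → K
  add_poly : ∃ P : Fin n → MvPolynomial (Fin n ⊕ Fin n) K,
    ∀ x y : Fin n → K, ∀ i, add x y i = MvPolynomial.eval (Sum.elim x y) (P i)
  mul_poly : ∃ P : Fin n → MvPolynomial (Fin n ⊕ Fin n) K,
    ∀ x y : Fin n → K, ∀ i, mul x y i = MvPolynomial.eval (Sum.elim x y) (P i)
  neg_poly : ∃ P : Fin n → MvPolynomial (Fin n) K,
    ∀ x : Fin n → K, ∀ i, neg x i = MvPolynomial.eval x (P i)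
  zero_mem : zero ∈ carrier
  one_mem : one ∈ carrier
  add_mem : ∀ {x y}, x ∈ carrier → y ∈ carrier → add x y ∈ carrier
  mul_mem : ∀ {x y}, x ∈ carrier → y ∈ carrier → mul x y ∈ carrier
  neg_mem : ∀ {x}, x ∈ carrier → neg x ∈ carrier
  add_comm' : ∀ x ∈ carrier, ∀ y ∈ carrier, add x y = add y x
  add_assoc' : ∀ x ∈ carrier, ∀ y ∈ carrier, ∀ z ∈ carrier,
    add (add x y) z = add x (add y z)
  zero_add' : ∀ x ∈ carrier, add zero x = x
  neg_add_cancel' : ∀ x ∈ carrier, add (neg x) x = zero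
  mul_assoc' : ∀ x ∈ carrier, ∀ y ∈ carrier, ∀ z ∈ carrier,
    mul (mul x y) z = mul x (mul y z)
  one_mul' : ∀ x ∈ carrier, mul one x = x
  mul_one' : ∀ x ∈ carrier, mul x one = x
  left_distrib' : ∀ x ∈ carrier, ∀ y ∈ carrier, ∀ z ∈ carrier,
    mul x (add y z) = add (mul x y) (mul x z)
  right_distrib' : ∀ x ∈ carrier, ∀ y ∈ carrier, ∀ z ∈ carrier,
    mul (add x y) z = add (mul x z) (mul y z)

namespace AlgebraicRing

variable {K : Type} [Field K] (A : AlgebraicRing K)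

/-- The points of the algebraic ring `A`. -/
def Elt : Type := {x : Fin A.n → K // x ∈ A.carrier}

instance : TopologicalSpace A.Elt :=
  TopologicalSpace.induced (fun x => x.1) (affineZariski K A.n)

instance : Add A.Elt := ⟨fun x y => ⟨A.add x.1 y.1, A.add_mem x.2 y.2⟩⟩
instance : Mul A.Elt := ⟨fun x y => ⟨A.mul x.1 y.1, A.mul_mem x.2 y.2⟩⟩
instance : Neg A.Elt := ⟨fun x => ⟨A.neg x.1, A.neg_mem x.2⟩⟩
instance : Zero A.Elt := ⟨⟨A.zero, A.zero_mem⟩⟩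
instance : One A.Elt := ⟨⟨A.one, A.one_mem⟩⟩

instance : AddCommGroup A.Elt where
  add_assoc a b c := Subtype.ext (A.add_assoc' _ a.2 _ b.2 _ c.2)
  zero_add a := Subtype.ext (A.zero_add' _ a.2)
  add_zero a := Subtype.ext (by
    show A.add a.1 A.zero = a.1
    rw [A.add_comm' _ a.2 _ A.zero_mem]
    exact A.zero_add' _ a.2)
  neg_add_cancel a := Subtype.ext (A.neg_add_cancel' _ a.2)
  add_comm a b := Subtype.ext (A.add_comm' _ a.2 _ b.2)
  nsmul := nsmulRec
  zsmul := zsmulRec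

instance : Ring A.Elt :=
  { (inferInstance : AddCommGroup A.Elt) with
    left_distrib := fun a b c => Subtype.ext (A.left_distrib' _ a.2 _ b.2 _ c.2)
    right_distrib := fun a b c => Subtype.ext (A.right_distrib' _ a.2 _ b.2 _ c.2)
    zero_mul := fun a => by
      have h : (0 : A.Elt) * a + (0 : A.Elt) * a = (0 : A.Elt) * a + 0 := by
        rw [add_zero]
        apply Subtype.ext
        show A.add (A.mul A.zero a.1) (A.mul A.zero a.1) = A.mul A.zero a.1
        rw [← A.right_distrib' _ A.zero_mem _ A.zero_mem _ a.2, A.zero_add' _ A.zero_mem]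
      exact add_left_cancel h
    mul_zero := fun a => by
      have h : a * (0 : A.Elt) + a * (0 : A.Elt) = a * (0 : A.Elt) + 0 := by
        rw [add_zero]
        apply Subtype.ext
        show A.add (A.mul a.1 A.zero) (A.mul a.1 A.zero) = A.mul a.1 A.zero
        rw [← A.left_distrib' _ a.2 _ A.zero_mem _ A.zero_mem, A.zero_add' _ A.zero_mem]
      exact add_left_cancel h
    mul_assoc := fun a b c => Subtype.ext (A.mul_assoc' _ a.2 _ b.2 _ c.2)
    one_mul := fun a => Subtype.ext (A.one_mul' _ a.2)
    mul_one := fun a => Subtype.ext (A.mul_one' _ a.2) }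

end AlgebraicRing

/-- A commutative algebraic ring. -/
structure CommAlgebraicRing (K : Type) [Field K] extends AlgebraicRing K where
  mul_comm' : ∀ x ∈ carrier, ∀ y ∈ carrier, mul x y = mul y x

namespace CommAlgebraicRing

variable {K : Type} [Field K] (A : CommAlgebraicRing K)

/-- The points of the commutative algebraic ring `A`. -/
abbrev Elt : Type := A.toAlgebraicRing.Elt

instance : CommRing A.Elt :=
  { (inferInstance : Ring A.toAlgebraicRing.Elt) with
    mul_comm := fun a b => Subtype.ext (by exact A.mul_comm' _ a.2 _ b.2) }

end CommAlgebraicRing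

end


namespace AlgebraicRing

variable {K : Type} [Field K] (A : AlgebraicRing K)

/-- The translation action of `a ∈ A` on functions on `A` (the regular representation of
the additive group of `A` on its coordinate ring). -/
def translate (a : A.Elt) (g : A.Elt → K) : A.Elt → K := fun x => g (a + x)

/-- The difference operator `τ_a - id` on functions on `A`. -/
def diffOp (a : A.Elt) (g : A.Elt → K) : A.Elt → K := fun x => g (a + x) - g x

/-- `a` is a unipotent element of the additive algebraic group `(A, +)`: the translation
operator `τ_a` acts locally unipotently on the coordinate ring (restrictions of
polynomials). -/
def IsUnipotentElt (a : A.Elt) : Prop :=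
  ∀ F : MvPolynomial (Fin A.n) K, ∃ m : ℕ,
    (A.diffOp a)^[m] (fun x : A.Elt => MvPolynomial.eval x.1 F) = 0

/-- `a` is a semisimple element of the additive algebraic group `(A, +)`: the translation
operator `τ_a` acts semisimply (diagonalizably) on the coordinate ring, i.e. every
regular function is a sum of `τ_a`-eigenvectors. -/
def IsSemisimpleElt (a : A.Elt) : Prop :=
  ∀ F : MvPolynomial (Fin A.n) K,
    (fun x : A.Elt => MvPolynomial.eval x.1 F) ∈
      Submodule.span K {g : A.Elt → K | ∃ c : K, A.translate a g = c • g}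

end AlgebraicRing

namespace AlgRingAux

open Polynomial

theorem finite_torsion_comm {K B : Type} [Field K] [CommRing B] [Algebra K B]
    [FiniteDimensional K B] (N : ℕ) (hN : (N : K) ≠ 0) : {t : B | t ^ N = 1}.Finite := by
  have hN0 : 0 < N := Nat.pos_of_ne_zero (by rintro rfl; simp at hN)
  haveI : IsArtinianRing B := IsArtinianRing.of_finite K B
  let φ : B → (∀ m : MaximalSpectrum B, B ⧸ m.asIdeal) := fun t m => Ideal.Quotient.mk _ t
  refine Set.Finite.of_finite_image (f := φ) ?_ ?_
  · refine Set.Finite.subset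
      (Set.Finite.pi' (t := fun m : MaximalSpectrum B => {x : B ⧸ m.asIdeal | x ^ N = 1}) ?_) ?_
    · intro m
      classical
      letI : Field (B ⧸ m.asIdeal) := Ideal.Quotient.field _
      have : {x : B ⧸ m.asIdeal | x ^ N = 1} ⊆ ((nthRoots N (1 : B ⧸ m.asIdeal)).toFinset : Set _) := by
        intro x hx
        simpa [mem_nthRoots hN0] using hx
      exact Set.Finite.subset (Finset.finite_toSet _) this
    · rintro _ ⟨t, ht, rfl⟩ m
      show (Ideal.Quotient.mk m.asIdeal t) ^ N = 1
      rw [← map_pow, ht, map_one]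
  · intro t ht t' ht' h
    have key := (Commute.all t t').mul_geom_sum₂ N
    rw [ht, ht', sub_self] at key
    have hu : IsUnit (∑ i ∈ Finset.range N, t ^ i * t' ^ (N - 1 - i)) := by
      by_contra hnu
      obtain ⟨M, hM, hmem⟩ := exists_max_ideal_of_mem_nonunits hnu
      have h1 := congrFun h ⟨M, hM⟩
      have h1' : Ideal.Quotient.mk M t = Ideal.Quotient.mk M t' := h1
      rw [← Ideal.Quotient.eq_zero_iff_mem, map_sum] at hmem
      have : ∀ i ∈ Finset.range N, Ideal.Quotient.mk M (t ^ i * t' ^ (N - 1 - i)) =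
          Ideal.Quotient.mk M (t ^ (N - 1)) := by
        intro i hi
        rw [map_mul, map_pow, map_pow, ← h1', ← pow_add, map_pow]
        congr 1
        have := Finset.mem_range.1 hi
        omega
      rw [Finset.sum_congr rfl this, Finset.sum_const, Finset.card_range, nsmul_eq_mul] at hmem
      have h2 : Ideal.Quotient.mk M ((N : B) * t ^ N) = 0 := by
        have : (N : B) * t ^ N = ((N : B) * t ^ (N - 1)) * t := by
          rw [mul_assoc, ← pow_succ, Nat.sub_add_cancel hN0]
        rw [this, map_mul, map_mul, map_natCast, hmem, zero_mul]
      rw [ht, mul_one, Ideal.Quotient.eq_zero_iff_mem] at h2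
      refine hM.ne_top (Ideal.eq_top_of_isUnit_mem _ h2 ?_)
      have := (isUnit_iff_ne_zero.2 hN).map (algebraMap K B)
      simpa using this
    have := hu.mul_left_eq_zero.1 key
    exact sub_eq_zero.1 this

theorem finite_torsion_end {K V : Type} [Field K] [AddCommGroup V] [Module K V]
    [FiniteDimensional K V] (N : ℕ) (hN : (N : K) ≠ 0) (S : Set (Module.End K V))
    (hc : ∀ a ∈ S, ∀ b ∈ S, a * b = b * a) (hS : ∀ a ∈ S, a ^ N = 1) : S.Finite := by
  letI : CommRing (Algebra.adjoin K S) := Algebra.adjoinCommRingOfComm K hc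
  haveI : FiniteDimensional K (Algebra.adjoin K S) :=
    inferInstanceAs (FiniteDimensional K (Subalgebra.toSubmodule (Algebra.adjoin K S)))
  have h := finite_torsion_comm (K := K) (B := Algebra.adjoin K S) N hN
  refine (h.image Subtype.val).subset ?_
  intro a ha
  refine ⟨⟨a, Algebra.subset_adjoin ha⟩, ?_, rfl⟩
  exact Subtype.ext (hS a ha)

theorem root_of_unity {K : Type} [Field K] (l : K) (hl : l ≠ 0) (W : Submodule K (ℕ → K))
    [FiniteDimensional K W] (hW : ∀ k : ℕ, (fun n : ℕ => (l ^ k) ^ n) ∈ W) :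
    ∃ N : ℕ, (N : K) ≠ 0 ∧ l ^ N = 1 := by
  have hfin : IsOfFinOrder l := by
    by_contra hinf
    have hinj : Function.Injective (fun k : ℕ => l ^ k) := by
      have aux : ∀ a b : ℕ, a < b → l ^ a ≠ l ^ b := by
        intro a b hab h
        apply hinf
        rw [isOfFinOrder_iff_pow_eq_one]
        refine ⟨b - a, Nat.sub_pos_of_lt hab, ?_⟩
        rw [← Nat.add_sub_cancel' hab.le, pow_add] at h
        exact (mul_left_cancel₀ (pow_ne_zero a hl) (by rw [mul_one]; exact h)).symm
      intro a b h
      rcases lt_trichotomy a b with h1 | h1 | h1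
      · exact absurd h (aux a b h1)
      · exact h1
      · exact absurd h.symm (aux b a h1)
    have li := (linearIndependent_monoidHom (Multiplicative ℕ) K).comp
      (fun k : ℕ => powersHom K (l ^ k)) (fun a b h => hinj ((powersHom K).injective h))
    have li2 : LinearIndependent K (fun k : ℕ => (⟨_, hW k⟩ : W)) := by
      refine LinearIndependent.of_comp W.subtype ?_
      exact li
    exact not_finite_iff_infinite.2 inferInstance (li2.finite)
  have hpos : 0 < orderOf l := hfin.orderOf_pos
  haveI : NeZero (orderOf l) := ⟨hpos.ne'⟩
  exact ⟨orderOf l, (IsPrimitiveRoot.orderOf l).neZero'.out, pow_orderOf_eq_one l⟩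

theorem unip_power {K V : Type} [Field K] [IsAlgClosed K] [AddCommGroup V] [Module K V]
    [FiniteDimensional K V] (t : Module.End K V)
    (h : ∀ l : K, t.HasEigenvalue l → ∃ N : ℕ, (N : K) ≠ 0 ∧ l ^ N = 1) :
    ∃ N m : ℕ, (N : K) ≠ 0 ∧ (t ^ N - 1) ^ m = 0 := by
  have h' : ∀ l : K, ∃ N : ℕ, (N : K) ≠ 0 ∧ (t.HasEigenvalue l → l ^ N = 1) := by
    intro l
    by_cases hl : t.HasEigenvalue l
    · obtain ⟨N, h1, h2⟩ := h l hl
      exact ⟨N, h1, fun _ => h2⟩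
    · exact ⟨1, by simp, fun h => absurd h hl⟩
  choose f hf0 hf using h'
  let R := (minpoly K t).roots
  let N := (R.map f).prod
  refine ⟨N, R.card, ?_, ?_⟩
  · show ((R.map f).prod : ℕ) ≠ (0 : K)
    rw [Nat.cast_multiset_prod]
    intro h0
    rw [Multiset.prod_eq_zero_iff] at h0
    simp only [Multiset.map_map, Multiset.mem_map, Function.comp] at h0
    obtain ⟨a, _, ha⟩ := h0
    exact hf0 a ha
  · have hm : (minpoly K t) = (R.map (fun a => X - C a)).prod :=
      (IsAlgClosed.splits (minpoly K t)).eq_prod_roots_of_monic (minpoly.monic (Algebra.IsIntegral.isIntegral t))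
    have hd : minpoly K t ∣ (X ^ N - 1) ^ R.card := by
      rw [hm]
      have : ((X : K[X]) ^ N - 1) ^ R.card = (R.map (fun _ => (X : K[X]) ^ N - 1)).prod := by simp
      rw [this]
      refine Multiset.prod_dvd_prod_of_dvd _ _ ?_
      intro a ha
      rw [dvd_iff_isRoot]
      have hae : t.HasEigenvalue a := by
        rw [Module.End.hasEigenvalue_iff_isRoot]
        exact (mem_roots'.1 ha).2
      have h1 : f a ∣ N := Multiset.dvd_prod (Multiset.mem_map_of_mem f ha)
      obtain ⟨c, hc⟩ := h1
      simp [IsRoot, hc, pow_mul, hf a hae]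
    have := (minpoly.dvd_iff.1 hd)
    simpa using this

theorem annih {K V : Type} [Field K] [AddCommGroup V] [Module K V] (t : Module.End K V)
    (P Q : K[X]) (hP : Squarefree P) (m : ℕ) (g : V) (h1 : aeval t P g = 0)
    (h2 : aeval t (Q ^ m) g = 0) : aeval t Q g = 0 := by
  classical
  have hd : EuclideanDomain.gcd P (Q ^ m) ∣ Q := by
    have hs : Squarefree (EuclideanDomain.gcd P (Q ^ m)) :=
      hP.squarefree_of_dvd (EuclideanDomain.gcd_dvd_left _ _)
    have h3 : EuclideanDomain.gcd P (Q ^ m) ∣ Q ^ (m + 1) :=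
      (EuclideanDomain.gcd_dvd_right _ _).trans (pow_dvd_pow _ (Nat.le_succ m))
    exact (hs.dvd_pow_iff_dvd (Nat.succ_ne_zero m)).1 h3
  have h4 : aeval t (EuclideanDomain.gcd P (Q ^ m)) g = 0 := by
    rw [EuclideanDomain.gcd_eq_gcd_ab, mul_comm P, mul_comm (Q ^ m), map_add, map_mul, map_mul,
      LinearMap.add_apply, Module.End.mul_apply, Module.End.mul_apply, h1, h2]
    simp
  obtain ⟨c, hc⟩ := hd
  rw [hc, mul_comm, map_mul, Module.End.mul_apply, h4, map_zero]

theorem span_annih {K V : Type} [Field K] [AddCommGroup V] [Module K V] (t : Module.End K V)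
    (g : V) (hg : g ∈ Submodule.span K {v : V | ∃ c : K, t v = c • v}) :
    ∃ P : K[X], Squarefree P ∧ aeval t P g = 0 := by
  classical
  have : ∃ s : Finset K, aeval t (∏ a ∈ s, (X - C a)) g = 0 := by
    induction hg using Submodule.span_induction with
    | mem v hv =>
      obtain ⟨c, hc⟩ := hv
      exact ⟨{c}, by simp [hc]⟩
    | zero => exact ⟨∅, by simp⟩
    | add x y _ _ hx hy =>
      obtain ⟨s, hs⟩ := hx
      obtain ⟨u, hu⟩ := hy
      refine ⟨s ∪ u, ?_⟩
      have h1 : (∏ a ∈ s, (X - C a : K[X])) ∣ ∏ a ∈ s ∪ u, (X - C a) :=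
        Finset.prod_dvd_prod_of_subset _ _ _ Finset.subset_union_left
      have h2 : (∏ a ∈ u, (X - C a : K[X])) ∣ ∏ a ∈ s ∪ u, (X - C a) :=
        Finset.prod_dvd_prod_of_subset _ _ _ Finset.subset_union_right
      rw [map_add]
      obtain ⟨c, hc⟩ := h1
      obtain ⟨d, hd⟩ := h2
      have e1 : aeval t (∏ a ∈ s ∪ u, (X - C a)) x = 0 := by
        rw [hc, mul_comm, map_mul, Module.End.mul_apply, hs, map_zero]
      have e2 : aeval t (∏ a ∈ s ∪ u, (X - C a)) y = 0 := by
        rw [hd, mul_comm, map_mul, Module.End.mul_apply, hu, map_zero]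
      rw [e1, e2, add_zero]
    | smul a x _ hx =>
      obtain ⟨s, hs⟩ := hx
      exact ⟨s, by rw [map_smul, hs, smul_zero]⟩
  obtain ⟨s, hs⟩ := this
  refine ⟨_, ?_, hs⟩
  exact (separable_prod_X_sub_C_iff'.2 (fun x _ y _ h => h)).squarefree

theorem span_of_pow {K V : Type} [Field K] [IsAlgClosed K] [AddCommGroup V] [Module K V]
    (t : Module.End K V) (N : ℕ) (hN : (N : K) ≠ 0) (ht : t ^ N = 1) (g : V) :
    g ∈ Submodule.span K {v : V | ∃ c : K, t v = c • v} := by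
  classical
  have hsep : (X ^ N - C (1 : K)).Separable := separable_X_pow_sub_C 1 hN one_ne_zero
  have key : ∀ s : Finset K, ∀ g : V, aeval t (∏ a ∈ s, (X - C a)) g = 0 →
      g ∈ Submodule.span K {v : V | ∃ c : K, t v = c • v} := by
    intro s g hg
    rcases s.eq_empty_or_nonempty with rfl | hs
    · simp at hg; simp [hg]
    have h1 := Lagrange.sum_basis (F := K) (s := s) (v := id) (Set.injOn_id _) hs
    have h2 : g = ∑ j ∈ s, aeval t (Lagrange.basis s id j) g := by
      have := congrArg (fun p => aeval t p g) h1
      simp only [map_sum, map_one, LinearMap.sum_apply, Module.End.one_apply] at this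
      exact this.symm
    rw [h2]
    refine Submodule.sum_mem _ (fun j hj => Submodule.subset_span ⟨j, ?_⟩)
    have h4 : ∃ c : K[X], (X - C j) * Lagrange.basis s id j = c * ∏ a ∈ s, (X - C a) := by
      refine ⟨∏ a ∈ s.erase j, C ((j - a)⁻¹), ?_⟩
      rw [← Finset.mul_prod_erase s _ hj, Lagrange.basis]
      simp only [Lagrange.basisDivisor, id, Finset.prod_mul_distrib]
      ring
    obtain ⟨c, hc⟩ := h4
    have h5 := congrArg (fun p => aeval t p g) hc
    simp only [map_mul, Module.End.mul_apply, hg, map_zero] at h5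
    rw [← sub_eq_zero]
    simpa using h5
  refine key (X ^ N - C (1 : K)).roots.toFinset g ?_
  have h6 : ∏ a ∈ (X ^ N - C (1 : K)).roots.toFinset, (X - C a) = X ^ N - C (1 : K) := by
    have hN0 : N ≠ 0 := by rintro rfl; simp at hN
    have := (IsAlgClosed.splits (X ^ N - C (1 : K))).eq_prod_roots_of_monic
      (monic_X_pow_sub_C 1 hN0)
    conv_rhs => rw [this]
    rw [Finset.prod, Multiset.toFinset_val, (Multiset.dedup_eq_self.2 (nodup_roots hsep))]
  rw [h6]
  simp [ht]

/-- Polynomial sequences. -/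
def PolySeq {K : Type} [Field K] (v : ℕ → K) : Prop := ∃ q : K[X], ∀ k : ℕ, v k = q.eval (k : K)

theorem PolySeq.mv {K σ : Type} [Field K] {v : ℕ → σ → K} (hv : ∀ i, PolySeq (fun k => v k i))
    (F : MvPolynomial σ K) : PolySeq (fun k => MvPolynomial.eval (v k) F) := by
  choose q hq using hv
  refine ⟨MvPolynomial.aeval q F, fun k => ?_⟩
  have : v k = fun i => (q i).eval (k : K) := funext fun i => hq i k
  beta_reduce
  rw [this]
  have h2 : (Polynomial.evalRingHom (k : K)) (MvPolynomial.aeval q F) = _ :=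
    MvPolynomial.map_aeval q (Polynomial.evalRingHom (k : K)) F
  rw [Polynomial.coe_evalRingHom] at h2
  rw [h2, MvPolynomial.eval, MvPolynomial.coe_eval₂Hom, MvPolynomial.coe_eval₂Hom]
  congr 1
  ext x
  simp

theorem poly_eq_of_nat {K : Type} [Field K] [CharZero K] (p q : K[X])
    (h : ∀ k : ℕ, p.eval (k : K) = q.eval (k : K)) : p = q := by
  refine Polynomial.eq_of_infinite_eval_eq p q ?_
  refine Set.Infinite.mono ?_ (Set.infinite_range_of_injective (Nat.cast_injective (R := K)))
  rintro _ ⟨k, rfl⟩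
  exact h k

theorem newton {K V : Type} [Field K] [CharZero K] [AddCommGroup V] [Module K V]
    (t : Module.End K V) (g : V) (m : ℕ) (h : ((t - 1) ^ m) g = 0) (φ : V →ₗ[K] K) :
    PolySeq (fun k => φ ((t ^ k) g)) := by
  refine ⟨∑ j ∈ Finset.range m, C (φ (((t - 1) ^ j) g) / (j.factorial : K)) * descPochhammer K j,
    fun k => ?_⟩
  have h1 : t ^ k = ((t - 1) + 1) ^ k := by simp
  have hz : ∀ j, m ≤ j → ((t - 1) ^ j) g = 0 := by
    intro j hj
    rw [← Nat.sub_add_cancel hj, pow_add, Module.End.mul_apply, h, map_zero]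
  beta_reduce
  rw [h1, (Commute.one_right (t - 1)).add_pow, LinearMap.sum_apply, map_sum]
  simp only [one_pow, mul_one, eval_finset_sum, eval_mul, eval_C]
  have h2 : ∀ j : ℕ, φ (((t - 1) ^ j * (k.choose j : Module.End K V)) g) =
      φ (((t - 1) ^ j) g) / (j.factorial : K) * (descPochhammer K j).eval (k : K) := by
    intro j
    rw [← (Nat.cast_commute (k.choose j) ((t-1)^j)).eq, ← nsmul_eq_mul, LinearMap.smul_apply, map_nsmul,
      nsmul_eq_mul, Nat.cast_choose_eq_descPochhammer_div K k j]
    ring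
  simp only [h2]
  have e1 : ∀ j, j ∉ Finset.range (k+1) → φ (((t - 1) ^ j) g) / (j.factorial : K) * (descPochhammer K j).eval (k : K) = 0 := by
    intro j hj
    rw [← h2, Nat.choose_eq_zero_of_lt (by simpa using hj)]
    simp
  have e2 : ∀ j, j ∉ Finset.range m → φ (((t - 1) ^ j) g) / (j.factorial : K) * (descPochhammer K j).eval (k : K) = 0 := by
    intro j hj
    rw [hz j (by simpa using hj)]
    simp
  rw [Finset.sum_subset (Finset.subset_union_left (s₂ := Finset.range m)) (fun j _ hj => e1 j hj),
    ← Finset.sum_subset (Finset.subset_union_right (s₁ := Finset.range (k+1))) (fun j _ hj => e2 j hj)]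

theorem fin_dim_of_poly {K σ τ : Type} [Field K] [Fintype σ] [Fintype τ]
    (F : MvPolynomial (σ ⊕ τ) K) : ∃ W : Submodule K ((σ → K) → K), FiniteDimensional K W ∧
      ∀ y : τ → K, (fun x : σ → K => MvPolynomial.eval (Sum.elim x y) F) ∈ W := by
  classical
  refine ⟨Submodule.span K ((fun (d : (σ ⊕ τ) →₀ ℕ) (x : σ → K) => ∏ i, x i ^ d (Sum.inl i)) ''
    (F.support : Set _)), FiniteDimensional.span_of_finite K ((Finset.finite_toSet _).image _), ?_⟩
  intro y
  have : (fun x : σ → K => MvPolynomial.eval (Sum.elim x y) F) =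
    ∑ d ∈ F.support, (F.coeff d * ∏ j, y j ^ d (Sum.inr j)) • (fun x : σ → K => ∏ i, x i ^ d (Sum.inl i)) := by
    ext x
    rw [MvPolynomial.eval_eq', Finset.sum_apply]
    refine Finset.sum_congr rfl (fun d _ => ?_)
    simp only [Fintype.prod_sum_type, Sum.elim_inl, Sum.elim_inr, Pi.smul_apply, smul_eq_mul]
    ring
  rw [this]
  exact Submodule.sum_mem _ (fun d hd => Submodule.smul_mem _ _ (Submodule.subset_span ⟨d, hd, rfl⟩))

end AlgRingAux

namespace AlgRingAux

open Polynomial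

variable {K : Type} [Field K] {A : AlgebraicRing K}

/-- Translation operator. -/
def tr (a : A.Elt) : Module.End K (A.Elt → K) := LinearMap.funLeft K K (fun x => a + x)

theorem tr_apply (a : A.Elt) (f : A.Elt → K) (x : A.Elt) : tr a f x = f (a + x) := rfl

theorem tr_mul (a b : A.Elt) : tr a * tr b = tr (a + b) := by
  refine LinearMap.ext fun f => funext fun x => ?_
  show f (b + (a + x)) = f ((a + b) + x)
  congr 1
  abel

theorem tr_zero : tr (0 : A.Elt) = 1 := by
  refine LinearMap.ext fun f => funext fun x => ?_
  show f (0 + x) = f x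
  rw [zero_add]

theorem tr_pow (a : A.Elt) (n : ℕ) : tr a ^ n = tr (n • a) := by
  induction n with
  | zero => rw [pow_zero, zero_smul, tr_zero]
  | succ n ih => rw [pow_succ, ih, tr_mul, succ_nsmul]

/-- Coordinate functions. -/
def coord (i : Fin A.n) : A.Elt → K := fun x => x.1 i

theorem eq_of_coord (a b : A.Elt) (h : ∀ i, coord i a = coord i b) : a = b :=
  Subtype.ext (funext h)

/-- Regular functions. -/
def Reg (f : A.Elt → K) : Prop := ∃ F : MvPolynomial (Fin A.n) K, f = fun x => MvPolynomial.eval x.1 F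

theorem diffOp_iter (a : A.Elt) (m : ℕ) (f : A.Elt → K) :
    (A.diffOp a)^[m] f = ((tr a - 1) ^ m) f := by
  induction m generalizing f with
  | zero => rfl
  | succ m ih =>
    rw [Function.iterate_succ_apply, ih, pow_succ, Module.End.mul_apply]
    rfl

theorem isUnip_iff (a : A.Elt) : A.IsUnipotentElt a ↔ ∀ f : A.Elt → K, Reg f → ∃ m : ℕ, ((tr a - 1) ^ m) f = 0 := by
  constructor
  · rintro h f ⟨F, rfl⟩
    obtain ⟨m, hm⟩ := h F
    exact ⟨m, by rw [← diffOp_iter]; exact hm⟩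
  · intro h F
    obtain ⟨m, hm⟩ := h _ ⟨F, rfl⟩
    exact ⟨m, by rw [diffOp_iter]; exact hm⟩

theorem isSemi_iff (a : A.Elt) : A.IsSemisimpleElt a ↔ ∀ f : A.Elt → K, Reg f →
    f ∈ Submodule.span K {g : A.Elt → K | ∃ c : K, tr a g = c • g} := by
  constructor
  · rintro h f ⟨F, rfl⟩
    exact h F
  · intro h F
    exact h _ ⟨F, rfl⟩

theorem reg_coord (i : Fin A.n) : Reg (coord (A := A) i) := ⟨MvPolynomial.X i, by ext x; simp [coord]⟩

theorem add_val (x y : A.Elt) : (x + y).1 = A.add x.1 y.1 := rfl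
theorem mul_val (x y : A.Elt) : (x * y).1 = A.mul x.1 y.1 := rfl

theorem reg_add_poly {f : A.Elt → K} (hf : Reg f) : ∃ P : MvPolynomial (Fin A.n ⊕ Fin A.n) K,
    ∀ x y : A.Elt, f (x + y) = MvPolynomial.eval (Sum.elim x.1 y.1) P := by
  obtain ⟨F, rfl⟩ := hf
  obtain ⟨P, hP⟩ := A.add_poly
  refine ⟨MvPolynomial.bind₁ P F, fun x y => ?_⟩
  rw [← MvPolynomial.aeval_eq_eval, MvPolynomial.aeval_bind₁]
  show MvPolynomial.eval _ F = _
  rw [← MvPolynomial.aeval_eq_eval]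
  congr 2
  ext i
  rw [MvPolynomial.aeval_eq_eval]
  exact hP x.1 y.1 i

theorem reg_mul_poly {f : A.Elt → K} (hf : Reg f) : ∃ P : MvPolynomial (Fin A.n ⊕ Fin A.n) K,
    ∀ x y : A.Elt, f (x * y) = MvPolynomial.eval (Sum.elim x.1 y.1) P := by
  obtain ⟨F, rfl⟩ := hf
  obtain ⟨P, hP⟩ := A.mul_poly
  refine ⟨MvPolynomial.bind₁ P F, fun x y => ?_⟩
  rw [← MvPolynomial.aeval_eq_eval, MvPolynomial.aeval_bind₁]
  show MvPolynomial.eval _ F = _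
  rw [← MvPolynomial.aeval_eq_eval]
  congr 2
  ext i
  rw [MvPolynomial.aeval_eq_eval]
  exact hP x.1 y.1 i

theorem reg_tr (a : A.Elt) {f : A.Elt → K} (hf : Reg f) : Reg (tr a f) := by
  obtain ⟨P, hP⟩ := reg_add_poly hf
  refine ⟨MvPolynomial.bind₁ (Sum.elim (fun i => MvPolynomial.C (a.1 i)) MvPolynomial.X) P, ?_⟩
  ext x
  rw [tr_apply, hP, ← MvPolynomial.aeval_eq_eval, ← MvPolynomial.aeval_eq_eval, MvPolynomial.aeval_bind₁]
  congr 2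
  ext i
  rcases i with i | i <;> simp

/-- The space of regular functions. -/
def RegSub (A : AlgebraicRing K) : Submodule K (A.Elt → K) where
  carrier := {f | Reg f}
  zero_mem' := ⟨0, by ext; simp⟩
  add_mem' := by
    rintro _ _ ⟨F, rfl⟩ ⟨G, rfl⟩
    exact ⟨F + G, by ext; simp⟩
  smul_mem' := by
    rintro c _ ⟨F, rfl⟩
    exact ⟨c • F, by ext; simp⟩

theorem fin_dim_translates {f : A.Elt → K} (hf : Reg f) :
    FiniteDimensional K (Submodule.span K (Set.range fun a : A.Elt => tr a f)) := by
  obtain ⟨P, hP⟩ := reg_add_poly hf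
  obtain ⟨W, hW, h⟩ := fin_dim_of_poly P
  let r : ((Fin A.n → K) → K) →ₗ[K] (A.Elt → K) := LinearMap.funLeft K K (fun x => x.1)
  haveI : FiniteDimensional K (W.map r) := inferInstance
  refine Submodule.finiteDimensional_of_le (S₂ := W.map r) (Submodule.span_le.2 ?_)
  rintro _ ⟨a, rfl⟩
  refine ⟨_, h a.1, ?_⟩
  ext x
  show MvPolynomial.eval (Sum.elim x.1 a.1) P = f (a + x)
  rw [← hP, add_comm]

/-- The space spanned by all translates of the coordinates. -/
def WW (A : AlgebraicRing K) : Submodule K (A.Elt → K) :=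
  ⨆ i : Fin A.n, Submodule.span K (Set.range fun a : A.Elt => tr a (coord i))

instance : FiniteDimensional K (WW A) := by
  haveI : ∀ i : Fin A.n, FiniteDimensional K
    (Submodule.span K (Set.range fun a : A.Elt => tr a (coord i))) :=
    fun i => fin_dim_translates (reg_coord i)
  unfold WW
  infer_instance

theorem coord_mem (i : Fin A.n) : coord i ∈ WW A := by
  refine Submodule.mem_iSup_of_mem i (Submodule.subset_span ⟨0, ?_⟩)
  simp only [tr_zero]
  rfl

theorem tr_mem (a : A.Elt) : ∀ f ∈ WW A, tr a f ∈ WW A := by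
  intro f hf
  have : WW A ≤ (WW A).comap (tr a) := by
    refine iSup_le fun i => Submodule.span_le.2 ?_
    rintro _ ⟨b, rfl⟩
    refine Submodule.mem_iSup_of_mem i (Submodule.subset_span ⟨a + b, ?_⟩)
    show tr (a + b) (coord i) = (tr a * tr b) (coord i)
    rw [tr_mul]
  exact this hf

theorem WW_le_reg : WW A ≤ RegSub A := by
  refine iSup_le fun i => Submodule.span_le.2 ?_
  rintro _ ⟨b, rfl⟩
  exact reg_tr b (reg_coord i)

/-- Restricted translation. -/
def trW (a : A.Elt) : Module.End K (WW A) := (tr a).restrict (tr_mem a)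

theorem trW_mul (a b : A.Elt) : trW a * trW b = trW (a + b) := by
  refine LinearMap.ext fun f => Subtype.ext ?_
  show (tr a * tr b) f.1 = _
  rw [tr_mul]
  rfl

theorem trW_zero : trW (0 : A.Elt) = 1 := by
  refine LinearMap.ext fun f => Subtype.ext ?_
  show tr 0 f.1 = _
  rw [tr_zero]
  rfl

theorem trW_pow (a : A.Elt) (n : ℕ) : trW a ^ n = trW (n • a) := by
  induction n with
  | zero => rw [pow_zero, zero_smul, trW_zero]
  | succ n ih => rw [pow_succ, ih, trW_mul, succ_nsmul]

theorem trW_inj : Function.Injective (trW : A.Elt → Module.End K (WW A)) := by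
  intro a b h
  refine eq_of_coord a b fun i => ?_
  have := congrArg (fun t : Module.End K (WW A) => (t ⟨_, coord_mem i⟩).1 0) h
  have h2 : coord i (a + 0) = coord i (b + 0) := this
  simpa using h2

theorem trW_sub_pow (a : A.Elt) (N m : ℕ) (w : WW A) :
    (((trW a ^ N - 1) ^ m) w).1 = ((tr a ^ N - 1) ^ m) w.1 := by
  rw [trW_pow, tr_pow]
  induction m generalizing w with
  | zero => rfl
  | succ m ih =>
    rw [pow_succ, pow_succ, Module.End.mul_apply, Module.End.mul_apply, ih]
    rfl

theorem eigen_root (a : A.Elt) (l : K) (f : A.Elt → K) (hf : Reg f) (hf0 : f ≠ 0)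
    (h : tr a f = l • f) : ∃ N : ℕ, (N : K) ≠ 0 ∧ l ^ N = 1 := by
  obtain ⟨z, hz⟩ := Function.ne_iff.1 hf0
  simp only [Pi.zero_apply] at hz
  have hl : l ≠ 0 := by
    rintro rfl
    apply hz
    have := congrFun h (-a + z)
    rw [tr_apply] at this
    simpa using this
  have hp : ∀ n : ℕ, f (n • a + z) = l ^ n * f z := by
    intro n
    show tr (n • a) f z = _
    rw [← tr_pow]
    induction n with
    | zero => simp
    | succ n ih =>
      rw [pow_succ, Module.End.mul_apply, h, map_smul, Pi.smul_apply, ih, smul_eq_mul]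
      ring
  obtain ⟨P, hP⟩ := reg_mul_poly (reg_tr z hf)
  obtain ⟨W, hW, hWm⟩ := fin_dim_of_poly P
  let r : ((Fin A.n → K) → K) →ₗ[K] (ℕ → K) :=
    LinearMap.funLeft K K (fun n : ℕ => (n • (1 : A.Elt)).1)
  haveI : FiniteDimensional K (W.map r) := inferInstance
  refine root_of_unity l hl (W.map r) fun k => ?_
  have h1 : (f z) • (fun n : ℕ => (l ^ k) ^ n) ∈ W.map r := by
    refine ⟨_, hWm (k • a).1, ?_⟩
    ext n
    show MvPolynomial.eval (Sum.elim (n • (1 : A.Elt)).1 (k • a).1) P = _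
    rw [← hP, tr_apply, smul_mul_assoc, one_mul, smul_smul, add_comm, hp]
    simp only [Pi.smul_apply, smul_eq_mul]
    rw [mul_comm n k, pow_mul, mul_comm]
  have h2 := Submodule.smul_mem _ (f z)⁻¹ h1
  rwa [smul_smul, inv_mul_cancel₀ hz, one_smul] at h2

theorem exists_N [IsAlgClosed K] (a : A.Elt) : ∃ N m : ℕ, (N : K) ≠ 0 ∧ (trW a ^ N - 1) ^ m = 0 := by
  refine unip_power (trW a) fun l hl => ?_
  obtain ⟨v, hv⟩ := hl.exists_hasEigenvector
  refine eigen_root a l v.1 (WW_le_reg v.2) ?_ ?_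
  · intro h
    exact hv.2 (Subtype.ext h)
  · exact congrArg Subtype.val hv.apply_eq_smul

/-- Torsion prime to the characteristic. -/
def SS (a : A.Elt) : Prop := ∃ N : ℕ, (N : K) ≠ 0 ∧ N • a = 0

theorem nsmul_eq_zero_of_coord (a : A.Elt) (N : ℕ) (h : ∀ i, (tr a ^ N - 1) (coord i) = 0) :
    N • a = 0 := by
  refine eq_of_coord _ _ fun i => ?_
  have := congrFun (h i) 0
  rw [tr_pow, LinearMap.sub_apply, Pi.sub_apply, tr_apply, add_zero] at this
  exact sub_eq_zero.1 this

theorem isSemi_iff_SS [IsAlgClosed K] (a : A.Elt) : A.IsSemisimpleElt a ↔ SS a := by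
  rw [isSemi_iff]
  constructor
  · intro h
    obtain ⟨N, m, hN, hm⟩ := exists_N a
    refine ⟨N, hN, nsmul_eq_zero_of_coord a N fun i => ?_⟩
    obtain ⟨P, hP, hPa⟩ := span_annih (tr a) _ (h _ (reg_coord i))
    have h3 := annih (tr a) P (X ^ N - 1) hP m (coord i) hPa ?_
    · simpa using h3
    · have := trW_sub_pow a N m ⟨_, coord_mem i⟩
      rw [hm] at this
      simpa using this.symm
  · rintro ⟨N, hN, h⟩ f _
    refine span_of_pow (tr a) N hN ?_ f
    rw [tr_pow, h, tr_zero]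

/-- Concrete unipotency. -/
def UU (a : A.Elt) : Prop :=
  (∃ p k : ℕ, p.Prime ∧ CharP K p ∧ p ^ k • a = 0) ∨
  (CharZero K ∧ ∀ i, PolySeq (fun k : ℕ => (k • a).1 i))

theorem tr_char (p k : ℕ) (hp : p.Prime) (hc : CharP K p) (a : A.Elt) :
    (tr a - 1) ^ p ^ k = tr a ^ p ^ k - 1 := by
  haveI := Fact.mk hp
  haveI : Nonempty A.Elt := ⟨0⟩
  haveI : CharP (Module.End K (A.Elt → K)) p :=
    charP_of_injective_algebraMap (algebraMap K (Module.End K (A.Elt → K))).injective p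
  have := sub_pow_char_pow_of_commute (p := p) (n := k) (Commute.one_right (tr a))
  rw [this, one_pow]

theorem char_cases (K : Type) [Field K] : (∃ p : ℕ, p.Prime ∧ CharP K p) ∨ CharZero K := by
  obtain ⟨p, hp⟩ := CharP.exists K
  rcases CharP.char_is_prime_or_zero K p with h | h
  · exact Or.inl ⟨p, h, hp⟩
  · subst h
    exact Or.inr (CharP.charP_to_charZero K)

theorem nsmul_polyseq [CharZero K] (a : A.Elt) (m : ℕ) (h : ∀ i, ((tr a - 1) ^ m) (coord i) = 0) :
    ∀ i, PolySeq (fun k : ℕ => (k • a).1 i) := by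
  intro i
  have := newton (tr a) (coord i) m (h i) (LinearMap.proj (0 : A.Elt))
  obtain ⟨q, hq⟩ := this
  refine ⟨q, fun k => ?_⟩
  rw [← hq k]
  show _ = (tr a ^ k) (coord i) 0
  rw [tr_pow, tr_apply, add_zero]
  rfl

theorem UU_to_unip (a : A.Elt) (h : UU a) : A.IsUnipotentElt a := by
  rw [isUnip_iff]
  intro f hf
  rcases h with ⟨p, k, hp, hc, h⟩ | ⟨hc, h⟩
  · refine ⟨p ^ k, ?_⟩
    rw [tr_char p k hp hc, tr_pow, h, tr_zero, sub_self]
    rfl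
  · obtain ⟨P, hP⟩ := reg_add_poly hf
    choose q hq using h
    let ι : K →+* (A.Elt → K) := algebraMap K (A.Elt → K)
    let Q : (A.Elt → K)[X] := MvPolynomial.eval₂ ((Polynomial.C).comp ι)
      (Sum.elim (fun i => (q i).map ι) (fun i => Polynomial.C (coord i))) P
    have hQ : ∀ k : ℕ, tr (k • a) f = Q.eval (k : A.Elt → K) := by
      intro k
      ext x
      have e : (Pi.evalRingHom (fun _ : A.Elt => K) x).comp (Polynomial.evalRingHom (k : A.Elt → K)) Q =
        MvPolynomial.eval (Sum.elim (k • a).1 x.1) P := by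
        show ((Pi.evalRingHom (fun _ : A.Elt => K) x).comp (Polynomial.evalRingHom (k : A.Elt → K)))
          (MvPolynomial.eval₂ _ _ P) = _
        rw [MvPolynomial.hom_eval₂, MvPolynomial.eval, MvPolynomial.coe_eval₂Hom]
        congr 1
        · ext c
          simp [ι]
        · ext i
          rcases i with i | i
          · have h5 : (k • a).1 i = (q i).eval (k : K) := hq i k
            simp only [Function.comp, Sum.elim_inl, h5]
            simp only [RingHom.coe_comp, Function.comp, Polynomial.coe_evalRingHom]
            rw [Polynomial.eval_map, ← map_natCast ι k, Polynomial.eval₂_at_apply]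
            simp [ι]
          · simp [coord]
      rw [tr_apply, hP, ← e]
      rfl
    refine ⟨Q.natDegree + 1, ?_⟩
    have h1 := Polynomial.fwdDiff_iter_degree_add_one_eq_zero Q
    have h2 := congrFun h1 0
    rw [fwdDiff_iter_eq_sum_shift] at h2
    rw [sub_eq_add_neg, (Commute.neg_one_right (tr a)).add_pow, LinearMap.sum_apply]
    rw [Pi.zero_apply] at h2
    rw [← h2]
    refine Finset.sum_congr rfl fun k _ => ?_
    have h3 : Q.eval (0 + k • (1 : A.Elt → K)) = tr (k • a) f := by
      rw [hQ, zero_add, nsmul_one]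
    rw [h3, tr_pow]
    generalize Q.natDegree + 1 - k = d
    generalize (Q.natDegree + 1).choose k = e
    have h4 : ((-1 : Module.End K (A.Elt → K)) ^ d) = (((-1 : ℤ) ^ d : ℤ) : Module.End K (A.Elt → K)) := by
      push_cast; rfl
    rw [h4, mul_assoc, ← Int.cast_natCast, ← Int.cast_mul, ← (Int.cast_commute _ _).eq, ← zsmul_eq_mul]
    rfl

theorem kill_char (p m : ℕ) (hp : p.Prime) (hc : CharP K p) (a : A.Elt)
    (hm : ∀ i, ((tr a - 1) ^ m) (coord i) = 0) : p ^ m • a = 0 := by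
  refine nsmul_eq_zero_of_coord _ _ fun i => ?_
  have hle : m ≤ p ^ m := (Nat.lt_pow_self hp.one_lt).le
  rw [← tr_char p m hp hc, ← Nat.sub_add_cancel hle, pow_add, Module.End.mul_apply, hm, map_zero]

theorem unip_to_UU (a : A.Elt) (h : A.IsUnipotentElt a) : UU a := by
  rw [isUnip_iff] at h
  have h' : ∃ m : ℕ, ∀ i, ((tr a - 1) ^ m) (coord i) = 0 := by
    choose m hm using fun i => h _ (reg_coord (A := A) i)
    refine ⟨∑ i, m i, fun i => ?_⟩
    have hle : m i ≤ ∑ i, m i := Finset.single_le_sum (fun _ _ => Nat.zero_le _) (Finset.mem_univ i)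
    rw [← Nat.sub_add_cancel hle, pow_add, Module.End.mul_apply, hm, map_zero]
  obtain ⟨m, hm⟩ := h'
  rcases char_cases K with ⟨p, hp, hc⟩ | hc
  · left
    exact ⟨p, m, hp, hc, kill_char p m hp hc a hm⟩
  · exact Or.inr ⟨hc, nsmul_polyseq a m hm⟩

theorem unip_iff_UU (a : A.Elt) : A.IsUnipotentElt a ↔ UU a := ⟨unip_to_UU a, UU_to_unip a⟩

end AlgRingAux

namespace AlgRingAux

open Polynomial

variable {K : Type} [Field K] {A : AlgebraicRing K}

theorem SS_add (a b : A.Elt) (ha : SS a) (hb : SS b) : SS (a + b) := by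
  obtain ⟨N, hN, h⟩ := ha
  obtain ⟨M, hM, h'⟩ := hb
  refine ⟨N * M, by push_cast; exact mul_ne_zero hN hM, ?_⟩
  rw [smul_add, mul_smul, mul_smul, h', smul_zero, add_zero, smul_comm, h, smul_zero]

theorem SS_mul_left (r a : A.Elt) (ha : SS a) : SS (r * a) := by
  obtain ⟨N, hN, h⟩ := ha
  exact ⟨N, hN, by rw [← mul_smul_comm, h, mul_zero]⟩

theorem SS_mul_right (r a : A.Elt) (ha : SS a) : SS (a * r) := by
  obtain ⟨N, hN, h⟩ := ha
  exact ⟨N, hN, by rw [← smul_mul_assoc, h, zero_mul]⟩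

theorem SS_neg (a : A.Elt) (ha : SS a) : SS (-a) := by
  rw [← neg_one_mul]; exact SS_mul_left _ _ ha

theorem SS_zero : SS (0 : A.Elt) := ⟨1, by simp, by simp⟩

theorem polyseq_const (c : K) : PolySeq (fun _ : ℕ => c) := ⟨C c, fun k => by simp⟩

theorem polyseq_add (v w : ℕ → A.Elt) (hv : ∀ i, PolySeq (fun k => (v k).1 i))
    (hw : ∀ i, PolySeq (fun k => (w k).1 i)) (i : Fin A.n) : PolySeq (fun k => (v k + w k).1 i) := by
  obtain ⟨P, hP⟩ := A.add_poly
  have h := PolySeq.mv (v := fun k => Sum.elim (v k).1 (w k).1)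
    (by rintro (j | j); exacts [hv j, hw j]) (P i)
  obtain ⟨q, hq⟩ := h
  refine ⟨q, fun k => ?_⟩
  rw [← hq k]
  exact hP _ _ i

theorem polyseq_mul (v w : ℕ → A.Elt) (hv : ∀ i, PolySeq (fun k => (v k).1 i))
    (hw : ∀ i, PolySeq (fun k => (w k).1 i)) (i : Fin A.n) : PolySeq (fun k => (v k * w k).1 i) := by
  obtain ⟨P, hP⟩ := A.mul_poly
  have h := PolySeq.mv (v := fun k => Sum.elim (v k).1 (w k).1)
    (by rintro (j | j); exacts [hv j, hw j]) (P i)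
  obtain ⟨q, hq⟩ := h
  refine ⟨q, fun k => ?_⟩
  rw [← hq k]
  exact hP _ _ i

theorem not_both {p : ℕ} (hp : p.Prime) (hc : CharP K p) (h0 : CharZero K) : False := by
  have := CharP.eq K hc (CharP.ofCharZero K)
  exact hp.ne_zero this

theorem UU_add (a b : A.Elt) (ha : UU a) (hb : UU b) : UU (a + b) := by
  rcases ha with ⟨p, k, hp, hc, h⟩ | ⟨hc, h⟩ <;> rcases hb with ⟨p', k', hp', hc', h'⟩ | ⟨hc', h'⟩
  · obtain rfl := CharP.eq K hc hc'
    refine Or.inl ⟨p, k + k', hp, hc, ?_⟩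
    rw [smul_add, pow_add, mul_smul, mul_smul, h', smul_zero, add_zero, smul_comm, h, smul_zero]
  · exact (not_both hp hc hc').elim
  · exact (not_both hp' hc' hc).elim
  · refine Or.inr ⟨hc, ?_⟩
    simp only [smul_add]
    exact polyseq_add _ _ h h'

theorem UU_mul_left (r a : A.Elt) (ha : UU a) : UU (r * a) := by
  rcases ha with ⟨p, k, hp, hc, h⟩ | ⟨hc, h⟩
  · exact Or.inl ⟨p, k, hp, hc, by rw [← mul_smul_comm, h, mul_zero]⟩
  · refine Or.inr ⟨hc, ?_⟩
    simp only [← mul_smul_comm]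
    exact polyseq_mul _ _ (fun i => polyseq_const _) h

theorem UU_mul_right (r a : A.Elt) (ha : UU a) : UU (a * r) := by
  rcases ha with ⟨p, k, hp, hc, h⟩ | ⟨hc, h⟩
  · exact Or.inl ⟨p, k, hp, hc, by rw [← smul_mul_assoc, h, zero_mul]⟩
  · refine Or.inr ⟨hc, ?_⟩
    simp only [← smul_mul_assoc]
    exact polyseq_mul _ _ h (fun i => polyseq_const _)

theorem UU_neg (a : A.Elt) (ha : UU a) : UU (-a) := by
  rw [← neg_one_mul]; exact UU_mul_left _ _ ha

theorem UU_zero : UU (0 : A.Elt) := by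
  rcases char_cases K with ⟨p, hp, hc⟩ | hc
  · exact Or.inl ⟨p, 0, hp, hc, by simp⟩
  · refine Or.inr ⟨hc, ?_⟩
    simp only [smul_zero]
    exact fun i => polyseq_const _

theorem coprime_of_char {p : ℕ} (hp : p.Prime) (hc : CharP K p) {N : ℕ} (hN : (N : K) ≠ 0) (k : ℕ) :
    Nat.Coprime N (p ^ k) := by
  refine Nat.Coprime.pow_right k (Nat.Coprime.symm ((Nat.Prime.coprime_iff_not_dvd hp).2 ?_))
  rwa [← CharP.cast_eq_zero_iff K p]

theorem bezout_split {N M : ℕ} (h : Nat.Coprime N M) : ∃ x y : ℤ, x * N + y * M = 1 := by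
  obtain ⟨x, y, hxy⟩ := (Nat.isCoprime_iff_coprime.2 h)
  exact ⟨x, y, hxy⟩

theorem UU_SS_zero (a : A.Elt) (hu : UU a) (hs : SS a) : a = 0 := by
  obtain ⟨N, hN, hs⟩ := hs
  rcases hu with ⟨p, k, hp, hc, h⟩ | ⟨hc, h⟩
  · obtain ⟨x, y, hxy⟩ := bezout_split (coprime_of_char hp hc hN k)
    have : a = (x * (N : ℤ) + y * ((p ^ k : ℕ) : ℤ)) • a := by rw [hxy, one_smul]
    rw [this, add_smul, mul_smul, mul_smul, natCast_zsmul, natCast_zsmul, hs, h]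
    simp
  · refine eq_of_coord _ _ fun i => ?_
    obtain ⟨q, hq⟩ := h i
    have h1 : q.comp (C (N : K) * X) = C (q.eval 0) := by
      refine poly_eq_of_nat _ _ fun k => ?_
      have h2 := hq (k * N)
      have h3 := hq 0
      simp only [mul_smul, hs, smul_zero, zero_smul] at h2 h3
      simp only [eval_comp, eval_mul, eval_C, eval_X]
      rw [h3] at h2
      push_cast at h2
      rw [mul_comm, ← h2]
    have h4 := congrArg (Polynomial.eval ((N : K)⁻¹)) h1
    simp only [eval_comp, eval_mul, eval_C, eval_X, mul_inv_cancel₀ hN] at h4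
    have h5 := hq 1
    have h6 := hq 0
    simp only [one_smul, zero_smul, Nat.cast_one, Nat.cast_zero] at h5 h6
    show a.1 i = (0 : A.Elt).1 i
    rw [h5, h6, h4]

theorem divide [CharZero K] (b : A.Elt) (hb : ∀ i, PolySeq (fun k : ℕ => (k • b).1 i)) (N : ℕ)
    (hN : (N : K) ≠ 0) : ∃ u : A.Elt, UU u ∧ N • u = b := by
  choose g hg using hb
  have hmem : ∀ t : K, (fun i => (g i).eval t) ∈ A.carrier := by
    intro t
    obtain ⟨S, hS⟩ := A.carrier_closed
    rw [hS]
    intro P hP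
    have h0 : MvPolynomial.aeval g P = 0 := by
      refine poly_eq_of_nat _ _ fun k => ?_
      have h1 : ∀ v ∈ A.carrier, MvPolynomial.eval v P = 0 := by
        intro v hv
        rw [hS] at hv
        exact hv P hP
      have h2 := h1 _ (k • b).2
      have h3 : (k • b).1 = fun i => (g i).eval (k : K) := funext fun i => hg i k
      rw [h3] at h2
      rw [eval_zero, ← h2]
      have h4 : (Polynomial.evalRingHom (k : K)) (MvPolynomial.aeval g P) = _ :=
        MvPolynomial.map_aeval g (Polynomial.evalRingHom (k : K)) P
      rw [Polynomial.coe_evalRingHom] at h4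
      rw [h4, MvPolynomial.eval, MvPolynomial.coe_eval₂Hom, MvPolynomial.coe_eval₂Hom]
      congr 1
      ext x
      simp
    have h4 : (Polynomial.evalRingHom t) (MvPolynomial.aeval g P) = _ :=
      MvPolynomial.map_aeval g (Polynomial.evalRingHom t) P
    rw [h0, map_zero, MvPolynomial.coe_eval₂Hom] at h4
    rw [MvPolynomial.eval, MvPolynomial.coe_eval₂Hom, h4]
    congr 1
    ext x
    simp
  let γ : K → A.Elt := fun t => ⟨fun i => (g i).eval t, hmem t⟩
  have hγn : ∀ k : ℕ, γ k = k • b := fun k => Subtype.ext (funext fun i => (hg i k).symm)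
  have hγ : ∀ k : ℕ, ∀ t : K, γ ((k + 1 : ℕ) * t) = γ (k * t) + γ t := by
    intro k t
    obtain ⟨P, hP⟩ := A.add_poly
    refine eq_of_coord _ _ fun i => ?_
    let Q : K[X] := MvPolynomial.aeval
      (Sum.elim (fun j => (g j).comp (C (k : K) * X)) g) (P i)
    have hQ : ∀ t : K, Q.eval t = coord i (γ (k * t) + γ t) := by
      intro t
      have h4 : (Polynomial.evalRingHom t) Q = _ :=
        MvPolynomial.map_aeval _ (Polynomial.evalRingHom t) (P i)
      rw [Polynomial.coe_evalRingHom] at h4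
      have h5 : coord i (γ (k * t) + γ t) = _ := hP _ _ i
      rw [h4, h5, MvPolynomial.eval, MvPolynomial.coe_eval₂Hom, MvPolynomial.coe_eval₂Hom]
      congr 1
      · ext x
        simp
      · ext j
        rcases j with j | j <;> simp [γ]
    have hE : (g i).comp (C ((k + 1 : ℕ) : K) * X) = Q := by
      refine poly_eq_of_nat _ _ fun n => ?_
      rw [hQ, ← Nat.cast_mul, hγn, hγn, ← add_smul, eval_comp, eval_mul, eval_C, eval_X, ← Nat.cast_mul]
      have := hg i ((k + 1) * n)
      rw [← this]
      show _ = ((k * n + n) • b).1 i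
      rw [Nat.succ_mul]
    rw [← hQ, ← hE]
    simp [coord, γ]
  have hγ' : ∀ k : ℕ, ∀ t : K, γ (k * t) = k • γ t := by
    intro k t
    induction k with
    | zero =>
      have := hγn 0
      simpa using this
    | succ k ih => rw [hγ, ih, succ_nsmul]
  refine ⟨γ (N : K)⁻¹, Or.inr ⟨inferInstance, fun i => ?_⟩, ?_⟩
  · refine ⟨(g i).comp (X * C (N : K)⁻¹), fun k => ?_⟩
    have h7 := congrArg (coord i) (hγ' k (N : K)⁻¹)
    refine h7.symm.trans ?_
    simp [γ, coord]
    rw [mul_comm]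
  · rw [← hγ', mul_inv_cancel₀ hN]
    have := hγn 1
    simpa using this

theorem exists_decomp [IsAlgClosed K] (a : A.Elt) : ∃ u s : A.Elt, UU u ∧ SS s ∧ a = u + s := by
  obtain ⟨N, m, hN, hm⟩ := exists_N a
  have hc : ∀ i, ((tr (N • a) - 1) ^ m) (coord i) = 0 := by
    intro i
    have := trW_sub_pow a N m ⟨_, coord_mem i⟩
    rw [hm, tr_pow] at this
    exact this.symm
  rcases char_cases K with ⟨p, hp, hch⟩ | hch
  · have h := kill_char p m hp hch _ hc
    obtain ⟨x, y, hxy⟩ := bezout_split (coprime_of_char hp hch hN m)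
    refine ⟨(x * (N : ℤ)) • a, (y * ((p ^ m : ℕ) : ℤ)) • a, Or.inl ⟨p, m, hp, hch, ?_⟩,
      ⟨N, hN, ?_⟩, ?_⟩
    · rw [mul_smul, natCast_zsmul, smul_comm, h, smul_zero]
    · rw [mul_smul, natCast_zsmul, smul_comm, smul_comm N, h, smul_zero]
    · rw [← add_smul, hxy, one_smul]
  · obtain ⟨u, hu, hNu⟩ := divide (N • a) (nsmul_polyseq _ m hc) N hN
    refine ⟨u, a - u, hu, ⟨N, hN, ?_⟩, by abel⟩
    rw [smul_sub, hNu, sub_self]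

theorem SS_finite [IsAlgClosed K] : {a : A.Elt | SS a}.Finite := by
  obtain ⟨u, e, hu, ⟨N, hN, he⟩, h1⟩ := exists_decomp (1 : A.Elt)
  have hall : ∀ c : A.Elt, SS c → N • c = 0 := by
    intro c hc
    have hcu : c * u = 0 := by
      refine UU_SS_zero _ (UU_mul_left _ _ hu) (SS_mul_right _ _ hc)
    have : c = c * e := by
      conv_lhs => rw [← mul_one c, h1, mul_add, hcu, zero_add]
    rw [this, ← mul_smul_comm, he, mul_zero]
  have hfin := finite_torsion_end (K := K) (V := WW A) N hN (trW '' {a : A.Elt | SS a}) ?_ ?_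
  · exact Set.Finite.of_finite_image hfin trW_inj.injOn
  · rintro _ ⟨a, _, rfl⟩ _ ⟨b, _, rfl⟩
    rw [trW_mul, trW_mul, add_comm]
  · rintro _ ⟨a, ha, rfl⟩
    rw [trW_pow, hall a ha, trW_zero]

theorem isOpen_reg (f : A.Elt → K) (hf : Reg f) : IsOpen {x : A.Elt | f x ≠ 0} := by
  obtain ⟨F, rfl⟩ := hf
  refine ⟨{x | MvPolynomial.eval x F ≠ 0}, ?_, rfl⟩
  exact TopologicalSpace.isOpen_generateFrom_of_mem ⟨F, rfl⟩

theorem t1 : T1Space A.Elt := by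
  rw [t1Space_iff_exists_open]
  intro x y hxy
  have : ∃ i, x.1 i ≠ y.1 i := by
    by_contra! h
    exact hxy (Subtype.ext (funext h))
  obtain ⟨i, hi⟩ := this
  refine ⟨{z | (z.1 i - y.1 i) ≠ 0}, isOpen_reg _ ⟨MvPolynomial.X i - MvPolynomial.C (y.1 i), ?_⟩, ?_, ?_⟩
  · ext z; simp
  · exact sub_ne_zero.2 hi
  · simp

theorem cont_mul (e : A.Elt) : Continuous (fun a : A.Elt => a * e) := by
  refine continuous_induced_rng.2 ?_
  refine continuous_generateFrom_iff.2 ?_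
  rintro _ ⟨F, rfl⟩
  obtain ⟨P, hP⟩ := reg_mul_poly (A := A) ⟨F, rfl⟩
  refine isOpen_reg (fun a : A.Elt => MvPolynomial.eval (a * e).1 F)
    ⟨MvPolynomial.bind₁ (Sum.elim MvPolynomial.X (fun i => MvPolynomial.C (e.1 i))) P, ?_⟩
  ext x
  have h := hP x e
  rw [h, ← MvPolynomial.aeval_eq_eval, ← MvPolynomial.aeval_eq_eval, MvPolynomial.aeval_bind₁]
  congr 2
  ext i
  rcases i with i | i <;> simp

theorem connected_unip [IsAlgClosed K] (h : ConnectedSpace A.Elt) (a : A.Elt) : UU a := by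
  obtain ⟨u, e, hu, he, h1⟩ := exists_decomp (1 : A.Elt)
  haveI := t1 (A := A)
  have hpre : IsPreconnected (Set.range fun a : A.Elt => a * e) :=
    isPreconnected_range (cont_mul e)
  have hfin : (Set.range fun a : A.Elt => a * e).Finite := by
    refine SS_finite.subset ?_
    rintro _ ⟨a, rfl⟩
    exact SS_mul_left _ _ he
  have he0 : e = 0 := by
    by_contra hne
    refine (hpre.infinite_of_nontrivial ⟨e, ⟨1, one_mul e⟩, 0, ⟨0, zero_mul e⟩, hne⟩) hfin
  have : a = a * u := by
    conv_lhs => rw [← mul_one a, h1, he0, add_zero]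
  rw [this]
  exact UU_mul_left _ _ hu

end AlgRingAux

/-- An algebraic ring `A` over an algebraically closed field `K` (of any
characteristic) decomposes as a direct sum of two-sided ideals `A = A' ⊕ C`, where `A'`
is the set of unipotent elements of the additive group `(A, +)` and `C` is the finite
set of semisimple elements.  In particular, if `A` is connected then every element of
the additive group of `A` is unipotent. -/
theorem stmt_11 (K : Type) [Field K] [IsAlgClosed K] (A : AlgebraicRing K) :
    (A.IsUnipotentElt 0 ∧
      (∀ a b : A.Elt, A.IsUnipotentElt a → A.IsUnipotentElt b → A.IsUnipotentElt (a + b)) ∧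
      (∀ a : A.Elt, A.IsUnipotentElt a → A.IsUnipotentElt (-a)) ∧
      (∀ r a : A.Elt, A.IsUnipotentElt a →
        A.IsUnipotentElt (r * a) ∧ A.IsUnipotentElt (a * r))) ∧
    (A.IsSemisimpleElt 0 ∧
      (∀ a b : A.Elt, A.IsSemisimpleElt a → A.IsSemisimpleElt b → A.IsSemisimpleElt (a + b)) ∧
      (∀ a : A.Elt, A.IsSemisimpleElt a → A.IsSemisimpleElt (-a)) ∧
      (∀ r a : A.Elt, A.IsSemisimpleElt a →
        A.IsSemisimpleElt (r * a) ∧ A.IsSemisimpleElt (a * r))) ∧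
    {a : A.Elt | A.IsSemisimpleElt a}.Finite ∧
    (∀ a : A.Elt, ∃! p : A.Elt × A.Elt,
      A.IsUnipotentElt p.1 ∧ A.IsSemisimpleElt p.2 ∧ a = p.1 + p.2) ∧
    (ConnectedSpace A.Elt → ∀ a : A.Elt, A.IsUnipotentElt a) := by
  have hU : ∀ a : A.Elt, A.IsUnipotentElt a ↔ AlgRingAux.UU a := AlgRingAux.unip_iff_UU
  have hS : ∀ a : A.Elt, A.IsSemisimpleElt a ↔ AlgRingAux.SS a := AlgRingAux.isSemi_iff_SS
  simp only [hU, hS]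
  refine ⟨⟨AlgRingAux.UU_zero, AlgRingAux.UU_add, AlgRingAux.UU_neg, fun r a h =>
    ⟨AlgRingAux.UU_mul_left r a h, AlgRingAux.UU_mul_right r a h⟩⟩,
    ⟨AlgRingAux.SS_zero, AlgRingAux.SS_add, AlgRingAux.SS_neg, fun r a h =>
    ⟨AlgRingAux.SS_mul_left r a h, AlgRingAux.SS_mul_right r a h⟩⟩,
    AlgRingAux.SS_finite, fun a => ?_, AlgRingAux.connected_unip⟩
  obtain ⟨u, s, hu, hs, h⟩ := AlgRingAux.exists_decomp a
  refine ⟨(u, s), ⟨hu, hs, h⟩, ?_⟩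
  rintro ⟨u', s'⟩ ⟨hu', hs', h'⟩
  simp only at hu' hs' h'
  have e : u' - u = s - s' := by
    rw [sub_eq_sub_iff_add_eq_add, ← h', h, add_comm]
  have e0 : u' - u = 0 := by
    refine AlgRingAux.UU_SS_zero _ ?_ ?_
    · rw [sub_eq_add_neg]
      exact AlgRingAux.UU_add _ _ hu' (AlgRingAux.UU_neg _ hu)
    · rw [e, sub_eq_add_neg]
      exact AlgRingAux.SS_add _ _ hs (AlgRingAux.SS_neg _ hs')
  rw [e0] at e
  exact Prod.ext (sub_eq_zero.1 e0) (sub_eq_zero.1 e.symm).symm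
end

section
/- Let $A$ be an algebraic ring over an algebraically closed field $K$ of characteristic zero. Then $A$ virtually comes from an algebra: $A \cong A' \oplus B$ as algebraic rings, where $A'$ is isomorphic as an algebraic ring to a finite-dimensional associative unital $K$-algebra (with its natural algebraic ring structure), and $B$ is a finite ring. -/
namespace AlgRingAux

section basic

open MvPolynomial

variable {K : Type} [Field K]

/-- Regular functions on `A`. -/
noncomputable def regFun (A : AlgebraicRing K) : Subalgebra K (A.Elt → K) :=
  (aeval (R := K) (fun (i : Fin A.n) (x : A.Elt) => x.1 i)).range

theorem aeval_pi_apply {X σ : Type} (f : σ → X → K) (p : MvPolynomial σ K) (x : X) :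
    (aeval f p) x = eval (fun i => f i x) p := by
  induction p using MvPolynomial.induction_on with
  | C a => simp
  | add p q hp hq => simp [hp, hq]
  | mul_X p i hp => simp [hp]

theorem mem_regFun {A : AlgebraicRing K} {f : A.Elt → K} :
    f ∈ regFun A ↔ ∃ p : MvPolynomial (Fin A.n) K, ∀ x, f x = eval x.1 p := by
  constructor
  · rintro ⟨p, hp⟩
    refine ⟨p, fun x => ?_⟩
    rw [← hp]
    exact aeval_pi_apply _ p x
  · rintro ⟨p, hp⟩
    refine ⟨p, ?_⟩
    funext x
    rw [hp x]
    exact aeval_pi_apply _ p x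

/-- Composition of regular functions. -/
theorem comp_mem {A : AlgebraicRing K} {X : Type} (O : Subalgebra K (X → K)) (g : X → A.Elt)
    (hg : ∀ i, (fun x => (g x).1 i) ∈ O) {f : A.Elt → K} (hf : f ∈ regFun A) :
    (fun x => f (g x)) ∈ O := by
  obtain ⟨p, hp⟩ := mem_regFun.1 hf
  have : (fun x => f (g x)) = aeval (fun i x => (g x).1 i) p := by
    funext x
    rw [hp, aeval_pi_apply]
  rw [this]
  have h2 : aeval (fun i x => (g x).1 i) p =
      O.val (aeval (fun i => (⟨fun x => (g x).1 i, hg i⟩ : O)) p) := by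
    rw [← AlgHom.comp_apply, comp_aeval]
    rfl
  rw [h2]
  exact Subtype.property _

theorem coord_mem_s12 (A : AlgebraicRing K) (i : Fin A.n) : (fun x : A.Elt => x.1 i) ∈ regFun A :=
  mem_regFun.2 ⟨X i, fun x => by simp⟩

/-- Separation of variables. -/
theorem split_poly {n : ℕ} (p : MvPolynomial (Fin n ⊕ Fin n) K) :
    ∃ (k : ℕ) (g m : Fin k → MvPolynomial (Fin n) K), ∀ x y : Fin n → K,
      eval (Sum.elim x y) p = ∑ j, eval x (g j) * eval y (m j) := by
  classical
  let e := p.support.equivFin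
  refine ⟨p.support.card,
    fun j => C (coeff (e.symm j).1 p) * ∏ i, X i ^ ((e.symm j).1 (Sum.inl i)),
    fun j => ∏ i, X i ^ ((e.symm j).1 (Sum.inr i)), fun x y => ?_⟩
  rw [eval_eq', ← Finset.sum_coe_sort, ← e.symm.sum_comp]
  refine Finset.sum_congr rfl fun j _ => ?_
  rw [Fintype.prod_sum_type]
  simp [map_prod, mul_assoc]

theorem eval_bind₁_aux {σ τ : Type} (f : τ → K) (P : σ → MvPolynomial τ K) (p : MvPolynomial σ K) :
    eval f (bind₁ P p) = eval (fun i => eval f (P i)) p := by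
  have := eval₂Hom_bind₁ (RingHom.id K) f P p
  exact this

theorem split_add (A : AlgebraicRing K) {f : A.Elt → K} (hf : f ∈ regFun A) :
    ∃ (k : ℕ) (g m : Fin k → A.Elt → K), (∀ j, g j ∈ regFun A) ∧ (∀ j, m j ∈ regFun A) ∧
      ∀ x y, f (x + y) = ∑ j, g j x * m j y := by
  obtain ⟨p, hp⟩ := mem_regFun.1 hf
  obtain ⟨P, hP⟩ := A.add_poly
  obtain ⟨k, g, m, h⟩ := split_poly (bind₁ P p)
  refine ⟨k, fun j x => eval x.1 (g j), fun j x => eval x.1 (m j),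
    fun j => mem_regFun.2 ⟨_, fun _ => rfl⟩, fun j => mem_regFun.2 ⟨_, fun _ => rfl⟩,
    fun x y => ?_⟩
  rw [hp, ← h, eval_bind₁_aux]
  congr 2
  funext i
  exact hP _ _ i

theorem split_mul (A : AlgebraicRing K) {f : A.Elt → K} (hf : f ∈ regFun A) :
    ∃ (k : ℕ) (g m : Fin k → A.Elt → K), (∀ j, g j ∈ regFun A) ∧ (∀ j, m j ∈ regFun A) ∧
      ∀ x y, f (x * y) = ∑ j, g j x * m j y := by
  obtain ⟨p, hp⟩ := mem_regFun.1 hf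
  obtain ⟨P, hP⟩ := A.mul_poly
  obtain ⟨k, g, m, h⟩ := split_poly (bind₁ P p)
  refine ⟨k, fun j x => eval x.1 (g j), fun j x => eval x.1 (m j),
    fun j => mem_regFun.2 ⟨_, fun _ => rfl⟩, fun j => mem_regFun.2 ⟨_, fun _ => rfl⟩,
    fun x y => ?_⟩
  rw [hp, ← h, eval_bind₁_aux]
  congr 2
  funext i
  exact hP _ _ i


/-- The additive group embeds in the units of a finite-dimensional commutative algebra. -/
theorem exists_alg (A : AlgebraicRing K) :
    ∃ (R : Type) (_ : CommRing R) (_ : Algebra K R) (_ : Module.Finite K R) (ρ : A.Elt → R),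
      ρ 0 = 1 ∧ (∀ a b, ρ (a + b) = ρ a * ρ b) ∧
      (∀ l : R →ₗ[K] K, (fun a => l (ρ a)) ∈ regFun A) ∧
      ∃ l : Fin A.n → R →ₗ[K] K, ∀ a i, l i (ρ a) = a.1 i := by
  choose k g m hg _ h using fun i => split_add A (coord_mem_s12 A i)
  let S := AddMonoidAlgebra K A.Elt
  let ext (V : Type) [AddCommGroup V] [Module K V] (f : A.Elt → V) : S →ₗ[K] V :=
    (Finsupp.linearCombination K f) ∘ₗ (AddMonoidAlgebra.coeffLinearEquiv K).toLinearMap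
  have hext : ∀ (V : Type) [AddCommGroup V] [Module K V] (f : A.Elt → V) a,
      ext V f (AddMonoidAlgebra.single a 1) = f a := by
    intro V _ _ f a
    have : AddMonoidAlgebra.coeffLinearEquiv K (AddMonoidAlgebra.single a (1 : K)) =
      Finsupp.single a 1 := rfl
    simp only [ext, LinearMap.comp_apply, LinearEquiv.coe_coe]
    rw [this]
    simp
  let l (i : Fin A.n) : S →ₗ[K] K := ext K (fun a => a.1 i)
  let G : S →ₗ[K] ((Σ i : Fin A.n, Fin (k i)) → K) := ext _ (fun a ij => g ij.1 ij.2 a)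
  let I : Ideal S :=
    { carrier := {r | ∀ s i, l i (s * r) = 0}
      add_mem' := by
        intro a b ha hb s i
        rw [mul_add, map_add, ha, hb, add_zero]
      zero_mem' := by intro s i; simp
      smul_mem' := by
        intro c x hx s i
        rw [smul_eq_mul, ← mul_assoc]
        exact hx _ _ }
  have key : ∀ r b i, l i (AddMonoidAlgebra.single b 1 * r) = ∑ j, G r ⟨i, j⟩ * m i j b := by
    intro r b i
    induction r using AddMonoidAlgebra.induction_on with
    | of a =>
      have h1 : G (AddMonoidAlgebra.of K A.Elt (Multiplicative.ofAdd a)) = fun ij => g ij.1 ij.2 a :=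
        hext _ _ a
      rw [h1]
      have h2 : AddMonoidAlgebra.single b 1 * AddMonoidAlgebra.of K A.Elt (Multiplicative.ofAdd a)
          = AddMonoidAlgebra.single (b + a) 1 := by
        simp
      rw [h2]
      refine (hext K _ _).trans ?_
      rw [add_comm]
      exact h i a b
    | add x y hx hy =>
      rw [mul_add, map_add, hx, hy, map_add, ← Finset.sum_add_distrib]
      exact Finset.sum_congr rfl fun j _ => by simp [add_mul]
    | smul c x hx =>
      rw [mul_smul_comm, map_smul, hx, map_smul, smul_eq_mul, Finset.mul_sum]
      exact Finset.sum_congr rfl fun j _ => by simp [mul_assoc]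
  have hker : ∀ r, G r = 0 → r ∈ I := by
    intro r hr s i
    induction s using AddMonoidAlgebra.induction_on with
    | of b =>
      refine (key r b i).trans ?_
      simp [hr]
    | add x y hx hy => rw [add_mul, map_add, hx, hy, add_zero]
    | smul c x hx => rw [smul_mul_assoc, map_smul, hx, smul_zero]
  let π : S →ₐ[K] S ⧸ I := Ideal.Quotient.mkₐ K I
  have hfac : ∀ (V : Type) [AddCommGroup V] [Module K V] (f : S →ₗ[K] V),
      (∀ r, G r = 0 → f r = 0) → ∃ f', f = f' ∘ₗ G := by
    intro V _ _ f hf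
    obtain ⟨f', hf'⟩ := LinearMap.exists_extend
      (((LinearMap.ker G).liftQ f (fun r hr => hf r hr)) ∘ₗ G.quotKerEquivRange.symm.toLinearMap)
    refine ⟨f', ?_⟩
    refine LinearMap.ext fun r => ?_
    have h1 := LinearMap.congr_fun hf' ⟨G r, LinearMap.mem_range_self G r⟩
    refine Eq.trans ?_ h1.symm
    rw [LinearMap.comp_apply, LinearEquiv.coe_coe, LinearMap.quotKerEquivRange_symm_apply_image]
    rfl
  refine ⟨S ⧸ I, inferInstance, inferInstance, ?_, fun a => π (AddMonoidAlgebra.single a 1),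
    ?_, ?_, ?_, ?_⟩
  · obtain ⟨f', hf'⟩ := hfac _ π.toLinearMap (fun r hr => Ideal.Quotient.eq_zero_iff_mem.2 (hker r hr))
    refine Module.Finite.of_surjective f' ?_
    intro y
    obtain ⟨r, rfl⟩ := Ideal.Quotient.mk_surjective y
    exact ⟨G r, (LinearMap.congr_fun hf' r).symm⟩
  · exact map_one π
  · intro a b
    rw [← map_mul, AddMonoidAlgebra.single_mul_single, one_mul]
  · intro L
    obtain ⟨f', hf'⟩ := hfac _ (L ∘ₗ π.toLinearMap) (fun r hr => by
      have : π r = 0 := Ideal.Quotient.eq_zero_iff_mem.2 (hker r hr)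
      simp [this])
    have : (fun a => L (π (AddMonoidAlgebra.single a 1))) =
        ∑ ij, f' (Pi.single ij 1) • g ij.1 ij.2 := by
      funext a
      have h1 := LinearMap.congr_fun hf' (AddMonoidAlgebra.single a 1)
      refine h1.trans ?_
      rw [LinearMap.comp_apply, hext, LinearMap.pi_apply_eq_sum_univ f']
      simp only [Finset.sum_apply, Pi.smul_apply, smul_eq_mul]
      exact Finset.sum_congr rfl fun ij _ => by
        rw [mul_comm]
        congr 2
        funext t
        simp [Pi.single_apply, eq_comm]
    rw [this]
    exact Subalgebra.sum_mem _ fun ij _ =>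
      Subalgebra.smul_mem _ (hg ij.1 ij.2) _
  · refine ⟨fun i => (I.restrictScalars K).liftQ (l i) ?_, fun a i => ?_⟩
    · intro r hr
      have := hr 1 i
      rwa [one_mul] at this
    · exact hext K _ a

end basic

section chars

variable {K : Type} [Field K]

theorem finite_homs {G : Type} [MulOneClass G] (F : Submodule K (G → K)) [FiniteDimensional K F] :
    {χ : G →* K | (χ : G → K) ∈ F}.Finite := by
  have h1 := (linearIndependent_monoidHom G K).comp
    (Subtype.val : {χ : G →* K | (χ : G → K) ∈ F} → (G →* K)) Subtype.val_injective
  let v : {χ : G →* K | (χ : G → K) ∈ F} → F := fun χ => ⟨χ.1, χ.2⟩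
  have h2 : LinearIndependent K v := LinearIndependent.of_comp F.subtype h1
  exact h2.finite

theorem char_torsion {A : AlgebraicRing K} (χ : A.Elt → K) (h0 : χ 0 = 1)
    (hadd : ∀ a b, χ (a + b) = χ a * χ b) (hχ : χ ∈ regFun A) :
    ∃ N : ℕ, 0 < N ∧ ∀ a, χ a ^ N = 1 := by
  obtain ⟨k, g, m, hg, hm, h⟩ := split_mul A hχ
  let F : Submodule K (Multiplicative A.Elt → K) :=
    Submodule.span K (Set.range fun j (y : Multiplicative A.Elt) => m j y.toAdd)
  have : FiniteDimensional K F := FiniteDimensional.span_of_finite K (Set.finite_range _)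
  let χ' (a : A.Elt) : Multiplicative A.Elt →* K :=
    { toFun := fun y => χ (a * y.toAdd)
      map_one' := by
        show χ (a * 0) = 1
        rw [mul_zero, h0]
      map_mul' := fun x y => by
        show χ (a * (x.toAdd + y.toAdd)) = _
        rw [mul_add, hadd] }
  have hF : ∀ a, (χ' a : Multiplicative A.Elt → K) ∈ F := by
    intro a
    have : (χ' a : Multiplicative A.Elt → K) =
        ∑ j, g j a • fun (y : Multiplicative A.Elt) => m j y.toAdd := by
      funext y
      refine (h a y.toAdd).trans ?_
      simp [Finset.sum_apply]
    rw [this]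
    exact Submodule.sum_mem _ fun j _ => Submodule.smul_mem _ _ (Submodule.subset_span ⟨j, rfl⟩)
  have hfin : (Set.range χ).Finite := by
    refine ((finite_homs F).image (fun f => f (Multiplicative.ofAdd 1))).subset ?_
    rintro _ ⟨a, rfl⟩
    refine ⟨χ' a, hF a, ?_⟩
    show χ (a * 1) = χ a
    rw [mul_one]
  let f : Multiplicative A.Elt →* K :=
    { toFun := fun a => χ a.toAdd
      map_one' := h0
      map_mul' := fun x y => hadd _ _ }
  let f' : Multiplicative A.Elt →* Kˣ := f.toHomUnits
  have hfin' : Finite f'.range := by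
    have : (Set.range f').Finite := by
      refine Set.Finite.of_finite_image (f := fun u : Kˣ => (u : K)) (hfin.subset ?_)
        (fun a _ b _ h => Units.ext h)
      rintro _ ⟨_, ⟨a, rfl⟩, rfl⟩
      exact ⟨a.toAdd, rfl⟩
    exact this
  refine ⟨Nat.card f'.range, Nat.card_pos, fun a => ?_⟩
  have h1 := pow_card_eq_one' (x := (⟨f' (Multiplicative.ofAdd a), ⟨_, rfl⟩⟩ : f'.range))
  have h2 := congrArg (fun u : f'.range => ((u : Kˣ) : K)) h1
  simpa [f', f] using h2

theorem nilp_of_homs [IsAlgClosed K] {R : Type} [CommRing R] [Algebra K R] [Module.Finite K R]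
    (r : R) (hr : ∀ l : R →ₐ[K] K, l r = 0) : IsNilpotent r := by
  rw [nilpotent_iff_mem_prime]
  intro J hJ
  have hb := IsAlgClosed.algebraMap_bijective_of_isIntegral (k := K) (K := R ⧸ J)
  let e := AlgEquiv.ofBijective (Algebra.ofId K (R ⧸ J)) hb
  have := hr (e.symm.toAlgHom.comp (Ideal.Quotient.mkₐ K J))
  have h2 : e.symm (Ideal.Quotient.mk J r) = 0 := this
  rw [map_eq_zero_iff _ e.symm.injective] at h2
  exact Ideal.Quotient.eq_zero_iff_mem.1 h2

theorem finite_algHom {R : Type} [CommRing R] [Algebra K R] [Module.Finite K R] :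
    Finite (R →ₐ[K] K) := by
  have h1 := (linearIndependent_monoidHom R K).comp
    (fun l : R →ₐ[K] K => (l : R →* K)) (fun a b h => AlgHom.ext fun x => DFunLike.congr_fun h x)
  let v : (R →ₐ[K] K) → Module.Dual K R := fun l => l.toLinearMap
  let c : Module.Dual K R →ₗ[K] (R → K) :=
    { toFun := fun f => f
      map_add' := fun _ _ => rfl
      map_smul' := fun _ _ => rfl }
  have h2 : LinearIndependent K v := LinearIndependent.of_comp c h1
  exact h2.finite

theorem exists_N_s12 [IsAlgClosed K] {A : AlgebraicRing K} {R : Type} [CommRing R] [Algebra K R]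
    [Module.Finite K R] (ρ : A.Elt → R) (h0 : ρ 0 = 1) (hadd : ∀ a b, ρ (a + b) = ρ a * ρ b)
    (hreg : ∀ l : R →ₗ[K] K, (fun a => l (ρ a)) ∈ regFun A) :
    ∃ N : ℕ, 0 < N ∧ ∀ (l : R →ₐ[K] K) a, l (ρ a) ^ N = 1 := by
  have := finite_algHom (K := K) (R := R)
  have := Fintype.ofFinite (R →ₐ[K] K)
  have h : ∀ l : R →ₐ[K] K, ∃ N : ℕ, 0 < N ∧ ∀ a, l (ρ a) ^ N = 1 := fun l =>
    char_torsion (fun a => l (ρ a)) (by simp [h0]) (fun a b => by simp [hadd])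
      (hreg l.toLinearMap)
  choose n hn hn' using h
  refine ⟨∏ l, n l, Finset.prod_pos fun l _ => hn l, fun l a => ?_⟩
  obtain ⟨c, hc⟩ := Finset.dvd_prod_of_mem n (Finset.mem_univ l)
  rw [hc, pow_mul, hn', one_pow]

end chars

section explog

open Polynomial

variable {K : Type} [Field K]

/-- Truncated exponential. -/
noncomputable def expPoly (K : Type) [Field K] (M : ℕ) : K[X] :=
  ∑ k ∈ Finset.range (M + 2), C ((k.factorial : K)⁻¹) * X ^ k

theorem expPoly_eq (M : ℕ) : ∃ G : K[X], expPoly K M = 1 + X + X ^ 2 * G := by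
  refine ⟨∑ k ∈ Finset.range M, C (((k + 2).factorial : K)⁻¹) * X ^ k, ?_⟩
  rw [expPoly, Finset.sum_range_succ', Finset.sum_range_succ', Finset.mul_sum]
  have : ∀ k, X ^ 2 * (C (((k + 2).factorial : K)⁻¹) * X ^ k) =
    C (((k + 1 + 1).factorial : K)⁻¹) * X ^ (k + 1 + 1) := fun k => by ring
  simp only [this]
  simp
  ring

variable [CharZero K] {R : Type} [CommRing R] [Algebra K R]

/-- Truncated exponential on an algebra. -/
noncomputable def tExp (K : Type) [Field K] {R : Type} [CommRing R] [Algebra K R] (M : ℕ) (y : R) :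
    R := aeval y (expPoly K M)

theorem tExp_add (M : ℕ) (y z : R) (hy : y ^ M = 0) (hz : z ^ M = 0) (hyz : (y + z) ^ M = 0) :
    tExp K M (y + z) = tExp K M y * tExp K M z := by
  let _ : Algebra ℚ R := Algebra.compHom R (algebraMap ℚ K)
  have key : ∀ y : R, y ^ M = 0 → tExp K M y = IsNilpotent.exp y := by
    intro y hy
    rw [IsNilpotent.exp_eq_sum (k := M + 2) (by rw [pow_add, hy, zero_mul]), tExp, expPoly, map_sum]
    refine Finset.sum_congr rfl fun k _ => ?_
    simp only [map_mul, aeval_C, map_pow, aeval_X, Algebra.smul_def]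
    congr 1
    show _ = algebraMap K R (algebraMap ℚ K _)
    simp
  rw [key _ hy, key _ hz, key _ hyz, IsNilpotent.exp_add_of_commute (Commute.all _ _) ⟨_, hy⟩ ⟨_, hz⟩]

theorem tExp_eq (M : ℕ) (y : R) : ∃ g, tExp K M y = 1 + y + y ^ 2 * g := by
  obtain ⟨G, hG⟩ := expPoly_eq (K := K) M
  exact ⟨aeval y G, by simp [tExp, hG]⟩

theorem tExp_zero (M : ℕ) : tExp K M (0 : R) = 1 := by
  obtain ⟨g, hg⟩ := tExp_eq (K := K) M (0 : R)
  simp [hg]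

theorem tExp_sub_one (M : ℕ) (y : R) (hy : IsNilpotent y) : IsNilpotent (tExp K M y - 1) := by
  obtain ⟨g, hg⟩ := tExp_eq (K := K) M y
  have : tExp K M y - 1 = y * (1 + y * g) := by rw [hg]; ring
  rw [this]
  exact (Commute.all _ _).isNilpotent_mul_right hy

theorem tExp_eq_one (M : ℕ) (y : R) (hy : IsNilpotent y) (h : tExp K M y = 1) : y = 0 := by
  obtain ⟨g, hg⟩ := tExp_eq (K := K) M y
  have h1 : y * (1 + y * g) = 0 := by
    have : y * (1 + y * g) = tExp K M y - 1 := by rw [hg]; ring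
    rw [this, h, sub_self]
  have h2 : IsUnit (1 + y * g) := ((Commute.all _ _).isNilpotent_mul_right hy).isUnit_one_add
  exact (h2.mul_left_eq_zero).1 h1

theorem tExp_inj (M : ℕ) (hM : ∀ y : R, IsNilpotent y → y ^ M = 0) {y z : R} (hy : IsNilpotent y)
    (hz : IsNilpotent z) (h : tExp K M y = tExp K M z) : y = z := by
  have hyz : IsNilpotent (y - z) := (Commute.all _ _).isNilpotent_sub hy hz
  have hn : IsNilpotent (-z) := hz.neg
  rw [← sub_eq_zero]
  refine tExp_eq_one (K := K) M _ hyz ?_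
  rw [sub_eq_add_neg] at hyz ⊢
  rw [tExp_add M y (-z) (hM _ hy) (hM _ hn) (hM _ hyz), h, ← tExp_add M z (-z) (hM _ hz) (hM _ hn)]
  · simp [tExp_zero]
  · rw [add_neg_cancel]; exact hM _ IsNilpotent.zero

theorem exists_log (M : ℕ) (hM : ∀ y : R, IsNilpotent y → y ^ M = 0) :
    ∃ L : K[X], ∀ u : R, IsNilpotent (u - 1) →
      IsNilpotent (aeval u L) ∧ tExp K M (aeval u L) = u := by
  obtain ⟨G, hG⟩ := expPoly_eq (K := K) M
  have hE : ∀ y : R, tExp K M y = 1 + y + y ^ 2 * aeval y G := fun y => by simp [tExp, hG]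
  have step : ∀ k : ℕ, ∃ L D : K[X], ∀ u : R, IsNilpotent (u - 1) →
      IsNilpotent (aeval u L) ∧
        tExp K M (-aeval u L) * u = 1 + (u - 1) ^ (k + 1) * aeval u D := by
    intro k
    induction k with
    | zero =>
      refine ⟨0, 1, fun u _ => ?_⟩
      simp [tExp_zero]
    | succ k ih =>
      obtain ⟨L, D, h⟩ := ih
      let Y : K[X] := (X - 1) ^ (k + 1) * D
      refine ⟨L + Y, (X - 1) ^ k * D ^ 2 * (-1 + (1 + Y) * G.comp (-Y)), fun u hu => ?_⟩
      obtain ⟨h1, h2⟩ := h u hu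
      have hY : aeval u Y = (u - 1) ^ (k + 1) * aeval u D := by simp [Y]
      have hyn : IsNilpotent (aeval u Y) := by
        rw [hY]
        exact (Commute.all _ _).isNilpotent_mul_right (hu.pow_succ k)
      have hs : IsNilpotent (aeval u (L + Y)) := by
        rw [map_add]
        exact (Commute.all _ _).isNilpotent_add h1 hyn
      refine ⟨hs, ?_⟩
      have h3 : tExp K M (-aeval u (L + Y)) =
          tExp K M (-aeval u L) * tExp K M (-aeval u Y) := by
        have h4 : -aeval u (L + Y) = -aeval u L + -aeval u Y := by rw [map_add]; ring
        rw [h4]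
        refine tExp_add M _ _ (hM _ h1.neg) (hM _ hyn.neg) (hM _ ?_)
        rw [← h4]
        exact hs.neg
      have h5 : aeval u (G.comp (-Y)) = aeval (-aeval u Y) G := by
        rw [aeval_comp, map_neg]
      rw [h3, mul_right_comm, h2, ← hY, hE]
      simp only [map_mul, map_add, map_pow, map_sub, map_neg, map_one, aeval_X, h5]
      generalize aeval (-aeval u Y) G = q
      rw [hY]
      ring
  obtain ⟨L, D, h⟩ := step M
  refine ⟨L, fun u hu => ?_⟩
  obtain ⟨h1, h2⟩ := h u hu
  refine ⟨h1, ?_⟩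
  rw [pow_succ, hM _ hu, zero_mul, zero_mul, add_zero] at h2
  have h3 : tExp K M (aeval u L) * tExp K M (-aeval u L) = 1 := by
    rw [← tExp_add M _ _ (hM _ h1) (hM _ h1.neg), add_neg_cancel, tExp_zero]
    rw [add_neg_cancel]; exact hM _ IsNilpotent.zero
  calc tExp K M (aeval u L) = tExp K M (aeval u L) * (tExp K M (-aeval u L) * u) := by
        rw [h2, mul_one]
    _ = u := by rw [← mul_assoc, h3, one_mul]

theorem exists_M (K : Type) [Field K] (R : Type) [CommRing R] [Algebra K R] [Module.Finite K R] :
    ∃ M : ℕ, ∀ y : R, IsNilpotent y → y ^ M = 0 := by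
  have : IsArtinianRing R := IsArtinianRing.of_finite K R
  obtain ⟨M, hM⟩ := IsArtinianRing.isNilpotent_nilradical (R := R)
  refine ⟨M, fun y hy => ?_⟩
  have := Ideal.pow_mem_pow (mem_nilradical.2 hy) M
  rw [hM] at this
  simpa using this

end explog

section vec

variable {K : Type} [Field K]

/-- Vector-valued regular functions. -/
noncomputable def vreg {X : Type} (O : Subalgebra K (X → K)) (R : Type) [CommRing R] [Algebra K R]
    [Module.Finite K R] : Subalgebra K (X → R) where
  carrier := {f | ∀ l : R →ₗ[K] K, (fun x => l (f x)) ∈ O}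
  add_mem' := by
    intro f g hf hg l
    have : (fun x => l ((f + g) x)) = (fun x => l (f x)) + fun x => l (g x) := by
      funext x; simp
    rw [this]
    exact O.add_mem (hf l) (hg l)
  mul_mem' := by
    intro f g hf hg l
    let b := Module.finBasis K R
    have : (fun x => l ((f * g) x)) = ∑ i, ∑ j, l (b i * b j) •
        ((fun x => b.coord i (f x)) * fun x => b.coord j (g x)) := by
      funext x
      have h1 : f x * g x = ∑ i, ∑ j, (b.coord i (f x) * b.coord j (g x)) • (b i * b j) := by
        conv_lhs => rw [← b.sum_repr (f x), ← b.sum_repr (g x)]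
        rw [Finset.sum_mul_sum]
        refine Finset.sum_congr rfl fun i _ => Finset.sum_congr rfl fun j _ => ?_
        rw [smul_mul_smul_comm]
        rfl
      show l (f x * g x) = _
      rw [h1]
      simp only [map_sum, map_smul, Finset.sum_apply, Pi.smul_apply, Pi.mul_apply, smul_eq_mul]
      refine Finset.sum_congr rfl fun i _ => Finset.sum_congr rfl fun j _ => ?_
      ring
    rw [this]
    exact O.sum_mem fun i _ => O.sum_mem fun j _ => O.smul_mem (O.mul_mem (hf _) (hg _)) _
  algebraMap_mem' := by
    intro r l
    exact O.algebraMap_mem (l (algebraMap K R r))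

theorem const_mem_vreg {X : Type} (O : Subalgebra K (X → K)) {R : Type} [CommRing R] [Algebra K R]
    [Module.Finite K R] (r : R) : (fun _ => r) ∈ vreg O R := fun l => O.algebraMap_mem (l r)

theorem aeval_mem_vreg {X : Type} {O : Subalgebra K (X → K)} {R : Type} [CommRing R] [Algebra K R]
    [Module.Finite K R] {f : X → R} (hf : f ∈ vreg O R) (p : Polynomial K) :
    (fun x => Polynomial.aeval (f x) p) ∈ vreg O R := by
  have h : (fun x => Polynomial.aeval (f x) p) = Polynomial.aeval f p := by
    funext x
    exact Polynomial.aeval_algHom_apply (Pi.evalAlgHom K (fun _ : X => R) x) f p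
  rw [h]
  have h2 : Polynomial.aeval f p = (vreg O R).val (Polynomial.aeval (⟨f, hf⟩ : vreg O R) p) :=
    Polynomial.aeval_algHom_apply (vreg O R).val (⟨f, hf⟩ : vreg O R) p
  rw [h2]
  exact Subtype.property _

theorem tExp_mem_vreg {X : Type} {O : Subalgebra K (X → K)} {R : Type} [CommRing R] [Algebra K R]
    [Module.Finite K R] {f : X → R} (hf : f ∈ vreg O R) (M : ℕ) :
    (fun x => tExp K M (f x)) ∈ vreg O R := aeval_mem_vreg hf _

/-- Polynomial functions on the line. -/
noncomputable def lineFun (K : Type) [Field K] : Subalgebra K (K → K) :=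
  (Polynomial.aeval (R := K) (fun t : K => t)).range

theorem id_mem_lineFun : (fun t : K => t) ∈ lineFun K := ⟨Polynomial.X, by simp⟩

theorem line_vanish [CharZero K] {f : K → K} (hf : f ∈ lineFun K) (h : ∀ n : ℕ, f n = 0) (t : K) :
    f t = 0 := by
  obtain ⟨p, rfl⟩ := hf
  have key : ∀ t, (Polynomial.aeval (fun t : K => t) p) t = p.eval t := by
    intro t
    have := Polynomial.aeval_algHom_apply (Pi.evalAlgHom K (fun _ : K => K) t) (fun t : K => t) p
    exact this.symm
  have hp : p = 0 := by
    refine Polynomial.eq_zero_of_infinite_isRoot p ?_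
    refine (Set.infinite_range_of_injective (Nat.cast_injective (R := K))).mono ?_
    rintro _ ⟨n, rfl⟩
    show p.eval _ = 0
    rw [← key]
    exact h n
  show (Polynomial.aeval (fun t : K => t) p) t = 0
  rw [key, hp]
  simp

theorem line_vanish_vec [CharZero K] {R : Type} [CommRing R] [Algebra K R] [Module.Finite K R]
    {f g : K → R} (hf : f ∈ vreg (lineFun K) R) (hg : g ∈ vreg (lineFun K) R)
    (h : ∀ n : ℕ, f n = g n) (t : K) : f t = g t := by
  rw [← sub_eq_zero, ← Module.forall_dual_apply_eq_zero_iff K]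
  intro l
  exact line_vanish ((vreg (lineFun K) R).sub_mem hf hg l) (fun n => by simp [h n]) t

theorem smul_mem_vreg_line {R : Type} [CommRing R] [Algebra K R] [Module.Finite K R] (y : R) :
    (fun t : K => t • y) ∈ vreg (lineFun K) R := by
  intro l
  have : (fun t : K => l (t • y)) = l y • fun t => t := by
    funext t; simp [mul_comm]
  rw [this]
  exact (lineFun K).smul_mem id_mem_lineFun _

theorem comp_mem_vreg {A : AlgebraicRing K} {X : Type} {O : Subalgebra K (X → K)} {R : Type}
    [CommRing R] [Algebra K R] [Module.Finite K R] (g : X → A.Elt)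
    (hg : ∀ i, (fun x => (g x).1 i) ∈ O) {f : A.Elt → R} (hf : f ∈ vreg (regFun A) R) :
    (fun x => f (g x)) ∈ vreg O R := fun l => comp_mem O g hg (hf l)

theorem mul_right_mem {A : AlgebraicRing K} (b : A.Elt) {f : A.Elt → K} (hf : f ∈ regFun A) :
    (fun x => f (x * b)) ∈ regFun A := by
  obtain ⟨k, g, m, hg, hm, h⟩ := split_mul A hf
  have : (fun x => f (x * b)) = ∑ j, m j b • g j := by
    funext x
    simp [h, Finset.sum_apply, mul_comm]
  rw [this]
  exact Subalgebra.sum_mem _ fun j _ => Subalgebra.smul_mem _ (hg j) _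

theorem mul_left_mem {A : AlgebraicRing K} (b : A.Elt) {f : A.Elt → K} (hf : f ∈ regFun A) :
    (fun x => f (b * x)) ∈ regFun A := by
  obtain ⟨k, g, m, hg, hm, h⟩ := split_mul A hf
  have : (fun x => f (b * x)) = ∑ j, g j b • m j := by
    funext x
    simp [h, Finset.sum_apply]
  rw [this]
  exact Subalgebra.sum_mem _ fun j _ => Subalgebra.smul_mem _ (hm j) _

/-- Polynomial functions on affine space. -/
noncomputable def affFun (K : Type) [Field K] (m : ℕ) : Subalgebra K ((Fin m → K) → K) :=
  (MvPolynomial.aeval (R := K) (fun (i : Fin m) (x : Fin m → K) => x i)).range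

theorem mem_affFun {m : ℕ} {f : (Fin m → K) → K} (hf : f ∈ affFun K m) :
    ∃ p : MvPolynomial (Fin m) K, ∀ x, f x = MvPolynomial.eval x p := by
  obtain ⟨p, rfl⟩ := hf
  exact ⟨p, fun x => aeval_pi_apply _ p x⟩

theorem linear_mem_affFun {m : ℕ} (l : (Fin m → K) →ₗ[K] K) : (fun x => l x) ∈ affFun K m := by
  have : (fun x => l x) = ∑ i, l (fun j => if i = j then 1 else 0) • fun x : Fin m → K => x i := by
    funext x
    rw [LinearMap.pi_apply_eq_sum_univ l]
    simp [Finset.sum_apply, mul_comm]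
  rw [this]
  have hX : ∀ j, (fun x : Fin m → K => x j) ∈ affFun K m := fun j => ⟨MvPolynomial.X j, by simp⟩
  exact Subalgebra.sum_mem _ fun j _ => Subalgebra.smul_mem _ (hX j) _

end vec

section structural

variable {K : Type} [Field K] [CharZero K] {R : Type} [CommRing R] [Algebra K R]

theorem tExp_nsmul (M : ℕ) (hM : ∀ y : R, IsNilpotent y → y ^ M = 0) {y : R} (hy : IsNilpotent y)
    (n : ℕ) : tExp K M ((n : K) • y) = tExp K M y ^ n := by
  induction n with
  | zero => simp [tExp_zero]
  | succ n ih =>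
    have h1 : IsNilpotent ((n : K) • y) := hy.smul _
    have h2 : ((n + 1 : ℕ) : K) • y = (n : K) • y + y := by
      rw [Nat.cast_succ, add_smul, one_smul]
    have h3 : IsNilpotent ((n : K) • y + y) := h2 ▸ hy.smul _
    rw [h2, tExp_add M _ _ (hM _ h1) (hM _ hy) (hM _ h3), ih, pow_succ]

theorem rho_nsmul {A : AlgebraicRing K} {ρ : A.Elt → R} (h0 : ρ 0 = 1)
    (hadd : ∀ a b, ρ (a + b) = ρ a * ρ b) (n : ℕ) (a : A.Elt) : ρ (n • a) = ρ a ^ n := by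
  induction n with
  | zero => simp [h0]
  | succ n ih => rw [succ_nsmul, hadd, ih, pow_succ]

theorem one_param [Module.Finite K R] {A : AlgebraicRing K} {ρ : A.Elt → R} (h0 : ρ 0 = 1)
    (hadd : ∀ a b, ρ (a + b) = ρ a * ρ b) (hreg : ρ ∈ vreg (regFun A) R)
    (l : Fin A.n → R →ₗ[K] K) (hl : ∀ a i, l i (ρ a) = a.1 i)
    (M : ℕ) (hM : ∀ y : R, IsNilpotent y → y ^ M = 0)
    (a : A.Elt) (y : R) (hy : IsNilpotent y) (hay : ρ a = tExp K M y) :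
    ∃ p : K → A.Elt, (∀ i, (fun t => (p t).1 i) ∈ lineFun K) ∧
      (∀ t, ρ (p t) = tExp K M (t • y)) ∧ ∀ n : ℕ, p n = n • a := by
  have he : (fun t : K => tExp K M (t • y)) ∈ vreg (lineFun K) R :=
    tExp_mem_vreg (smul_mem_vreg_line y) M
  have hn : ∀ n : ℕ, tExp K M ((n : K) • y) = ρ (n • a) := fun n => by
    rw [tExp_nsmul M hM hy, rho_nsmul h0 hadd, hay]
  have hcoord : ∀ (n : ℕ) i, l i (tExp K M ((n : K) • y)) = (n • a).1 i := fun n i => by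
    rw [hn, hl]
  obtain ⟨S, hS⟩ := A.carrier_closed
  have hmem : ∀ t : K, (fun i => l i (tExp K M (t • y))) ∈ A.carrier := by
    intro t
    rw [hS]
    intro q hq
    have h1 : (fun t : K => MvPolynomial.eval (fun i => l i (tExp K M (t • y))) q) ∈ lineFun K := by
      have : (fun t : K => MvPolynomial.eval (fun i => l i (tExp K M (t • y))) q) =
          (lineFun K).val (MvPolynomial.aeval
            (fun i => (⟨fun t => l i (tExp K M (t • y)), he (l i)⟩ : lineFun K)) q) := by
        rw [← AlgHom.comp_apply, MvPolynomial.comp_aeval]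
        funext t
        exact (aeval_pi_apply (fun i t => l i (tExp K M (t • y))) q t).symm
      rw [this]
      exact Subtype.property _
    refine line_vanish h1 (fun n => ?_) t
    have h2 : (fun i => l i (tExp K M ((n : K) • y))) = (n • a).1 := funext (hcoord n)
    have h3 : (n • a).1 ∈ {x | ∀ p ∈ S, MvPolynomial.eval x p = 0} := hS ▸ (n • a).2
    show MvPolynomial.eval (fun i => l i (tExp K M ((n : K) • y))) q = 0
    rw [h2]
    exact h3 q hq
  let p : K → A.Elt := fun t => ⟨fun i => l i (tExp K M (t • y)), hmem t⟩
  have hp : ∀ n : ℕ, p n = n • a := fun n => Subtype.ext (funext (hcoord n))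
  have hp' : ∀ i, (fun t => (p t).1 i) ∈ lineFun K := fun i => he (l i)
  refine ⟨p, hp', ?_, hp⟩
  refine line_vanish_vec (comp_mem_vreg p hp' hreg) he fun n => ?_
  show ρ (p n) = _
  rw [hp, hn]

end structural

theorem structure_thm {K : Type} [Field K] [IsAlgClosed K] [CharZero K] (A : AlgebraicRing K) :
    ∃ (m N : ℕ) (φ : A.Elt → Fin m → K), 0 < N ∧ (∀ a b, φ (a + b) = φ a + φ b) ∧
      Function.Surjective φ ∧ (∀ a, φ a = 0 ↔ N • a = 0) ∧
      (∀ i, (fun a => φ a i) ∈ regFun A) ∧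
      (∀ a, ∃ p : K → A.Elt, (∀ i, (fun t => (p t).1 i) ∈ lineFun K) ∧
        (∀ t, φ (p t) = (N * t) • φ a) ∧ ∀ n : ℕ, p n = (n * N) • a) ∧
      (∀ b : A.Elt, ∃ Q : Fin A.n → MvPolynomial (Fin m) K, ∀ z i,
        (b + N • z).1 i = MvPolynomial.eval (φ (b + N • z)) (Q i)) ∧
      ∃ (T : Type) (_ : Finite T) (f : A.Elt → T), ∀ x y, f x = f y → ∃ z, x = y + N • z := by
  obtain ⟨R, _, _, _, ρ, h0, hadd, hreg, l, hl⟩ := exists_alg A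
  replace hreg : ρ ∈ vreg (regFun A) R := hreg
  obtain ⟨N, hN, hchar⟩ := exists_N_s12 ρ h0 hadd hreg
  obtain ⟨M, hM⟩ := exists_M K R
  obtain ⟨L, hL⟩ := exists_log (K := K) (R := R) M hM
  have hNK : (N : K) ≠ 0 := Nat.cast_ne_zero.2 hN.ne'
  have hinj : ∀ a b, ρ a = ρ b → a = b := fun a b h =>
    Subtype.ext (funext fun i => by rw [← hl, ← hl, h])
  have hu : ∀ a, IsNilpotent (ρ a ^ N - 1) := fun a =>
    nilp_of_homs (K := K) _ fun f => by simp [hchar]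
  let Φ : A.Elt → R := fun a => Polynomial.aeval (ρ a ^ N) L
  have hΦn : ∀ a, IsNilpotent (Φ a) := fun a => (hL _ (hu a)).1
  have hΦe : ∀ a, tExp K M (Φ a) = ρ a ^ N := fun a => (hL _ (hu a)).2
  have hΦr : Φ ∈ vreg (regFun A) R := aeval_mem_vreg ((vreg (regFun A) R).pow_mem hreg N) L
  have hΦadd : ∀ a b, Φ (a + b) = Φ a + Φ b := by
    intro a b
    have hs : IsNilpotent (Φ a + Φ b) := (Commute.all _ _).isNilpotent_add (hΦn a) (hΦn b)
    refine tExp_inj (K := K) M hM (hΦn _) hs ?_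
    rw [tExp_add M _ _ (hM _ (hΦn a)) (hM _ (hΦn b)) (hM _ hs), hΦe, hΦe, hΦe, hadd, mul_pow]
  have hΦ0 : ∀ a, Φ a = 0 ↔ N • a = 0 := by
    intro a
    constructor
    · intro h
      apply hinj
      rw [rho_nsmul h0 hadd, ← hΦe, h, tExp_zero, h0]
    · intro h
      refine tExp_eq_one (K := K) M _ (hΦn a) ?_
      rw [hΦe, ← rho_nsmul h0 hadd, h, h0]
  have hpar : ∀ a, ∃ p : K → A.Elt, (∀ i, (fun t => (p t).1 i) ∈ lineFun K) ∧
        (∀ t, Φ (p t) = (N * t) • Φ a) ∧ ∀ n : ℕ, p n = (n * N) • a := by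
    intro a
    obtain ⟨p, hp1, hp2, hp3⟩ := one_param h0 hadd hreg l hl M hM (N • a) (Φ a) (hΦn a)
      (by rw [hΦe, rho_nsmul h0 hadd])
    refine ⟨p, hp1, fun t => ?_, fun n => by rw [hp3, mul_nsmul']⟩
    refine tExp_inj (K := K) M hM (hΦn _) ((hΦn a).smul _) ?_
    rw [hΦe, hp2, ← tExp_nsmul M hM ((hΦn a).smul _), smul_smul]
  have hΦzero : Φ 0 = 0 := (hΦ0 0).2 (smul_zero N)
  let W : Submodule K R :=
    { carrier := Set.range Φ
      add_mem' := by
        rintro _ _ ⟨a, rfl⟩ ⟨b, rfl⟩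
        exact ⟨a + b, hΦadd a b⟩
      zero_mem' := ⟨0, hΦzero⟩
      smul_mem' := by
        rintro c _ ⟨a, rfl⟩
        obtain ⟨p, -, hp, -⟩ := hpar a
        refine ⟨p ((N : K)⁻¹ * c), ?_⟩
        rw [hp, mul_inv_cancel_left₀ hNK] }
  let e : W ≃ₗ[K] (Fin (Module.finrank K W) → K) := (Module.finBasis K W).equivFun
  let φ : A.Elt → Fin (Module.finrank K W) → K := fun a => e ⟨Φ a, a, rfl⟩
  have hφ : ∀ a, (e.symm (φ a) : R) = Φ a := fun a => by simp [φ]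
  have hφinj : ∀ v w : Fin (Module.finrank K W) → K, (e.symm v : R) = e.symm w → v = w :=
    fun v w h => e.symm.injective (Subtype.ext h)
  refine ⟨_, N, φ, hN, ?_, ?_, ?_, ?_, ?_, ?_, ?_⟩
  · intro a b
    apply hφinj
    simp [hφ, hΦadd]
  · intro v
    obtain ⟨a, ha⟩ := (e.symm v).2
    exact ⟨a, hφinj _ _ (by rw [hφ, ha])⟩
  · intro a
    rw [← hΦ0, ← hφ]
    simp
  · intro i
    obtain ⟨g, hg⟩ := LinearMap.exists_extend (LinearMap.proj i ∘ₗ e.toLinearMap)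
    have : (fun a => φ a i) = fun a => g (Φ a) := by
      funext a
      exact (LinearMap.congr_fun hg ⟨Φ a, a, rfl⟩).symm
    rw [this]
    exact hΦr g
  · intro a
    obtain ⟨p, hp1, hp2, hp3⟩ := hpar a
    refine ⟨p, hp1, fun t => ?_, hp3⟩
    apply hφinj
    simp [hφ, hp2]
  · intro b
    have hlin : (fun v : Fin (Module.finrank K W) → K => (e.symm v : R)) ∈
        vreg (affFun K _) R := fun g => linear_mem_affFun (g ∘ₗ W.subtype ∘ₗ e.symm.toLinearMap)
    have hE : (fun v : Fin (Module.finrank K W) → K =>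
        ρ b * tExp K M ((N : K)⁻¹ • ((e.symm v : R) - Φ b))) ∈ vreg (affFun K _) R :=
      (vreg (affFun K _) R).mul_mem (const_mem_vreg _ _) (tExp_mem_vreg
        ((vreg (affFun K _) R).smul_mem ((vreg (affFun K _) R).sub_mem hlin (const_mem_vreg _ _)) _)
        M)
    choose Q hQ using fun i => mem_affFun (hE (l i))
    refine ⟨Q, fun z i => ?_⟩
    rw [← hQ]
    show _ = l i (ρ b * tExp K M ((N : K)⁻¹ • ((e.symm (φ (b + N • z)) : R) - Φ b)))
    rw [hφ, ← hl, hadd, rho_nsmul h0 hadd, ← hΦe, hΦadd, add_sub_cancel_left]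
    have hNz : ∀ n : ℕ, Φ (n • z) = (n : K) • Φ z := by
      intro n
      induction n with
      | zero => simp [hΦzero]
      | succ n ih => rw [succ_nsmul, hΦadd, ih, Nat.cast_succ, add_smul, one_smul]
    rw [hNz, smul_smul, inv_mul_cancel₀ hNK, one_smul]
  · classical
    have := finite_algHom (K := K) (R := R)
    have hfin : {g : (R →ₐ[K] K) → K | ∀ f, g f ∈ {z : K | z ^ N = 1}}.Finite := by
      refine Set.Finite.pi' fun f => ?_
      refine (Polynomial.nthRoots N (1 : K)).toFinset.finite_toSet.subset ?_
      intro z hz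
      simpa [Polynomial.mem_nthRoots hN] using hz
    refine ⟨{g : (R →ₐ[K] K) → K | ∀ f, g f ∈ {z : K | z ^ N = 1}}, hfin,
      fun x => ⟨fun f => f (ρ x), fun f => hchar f x⟩, fun x y hxy => ?_⟩
    have hxy' : ∀ f : R →ₐ[K] K, f (ρ x) = f (ρ y) := fun f =>
      congrFun (congrArg Subtype.val hxy) f
    have hn1 : IsNilpotent (ρ (x - y) - 1) := by
      refine nilp_of_homs (K := K) _ fun f => ?_
      have h1 : f (ρ (x - y)) * f (ρ y) = f (ρ y) := by
        rw [← map_mul, ← hadd, sub_add_cancel, hxy']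
      have h2 : f (ρ y) ≠ 0 := by
        intro h
        have := hchar f y
        rw [h, zero_pow hN.ne'] at this
        exact zero_ne_one this
      rw [map_sub, map_one, sub_eq_zero]
      exact mul_right_cancel₀ h2 (by rw [h1, one_mul])
    obtain ⟨h1, h2⟩ := hL _ hn1
    obtain ⟨p, -, hp2, -⟩ := one_param h0 hadd hreg l hl M hM (x - y) _ h1 h2.symm
    refine ⟨p ((N : K)⁻¹), ?_⟩
    rw [← sub_eq_iff_eq_add']
    apply hinj
    rw [rho_nsmul h0 hadd, hp2, ← tExp_nsmul M hM (h1.smul _), smul_smul, mul_inv_cancel₀ hNK,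
      one_smul, h2]

end AlgRingAux

/-- Over an algebraically closed field `K` of characteristic zero, every
algebraic ring virtually comes from an algebra: `A ≅ A' ⊕ B` as algebraic rings, where
`A'` is (isomorphic, as an algebraic ring, to) a finite-dimensional associative unital
`K`-algebra `K^m` with bilinear multiplication `mulS`, and `B` is a finite ring (the
quotient by a `RingCon` with finite quotient).  The isomorphism is regular in both
directions. -/
theorem stmt_12 (K : Type) [Field K] [IsAlgClosed K] [CharZero K] (A : AlgebraicRing K) :
    ∃ (m : ℕ) (mulS : (Fin m → K) →ₗ[K] (Fin m → K) →ₗ[K] (Fin m → K)) (oneS : Fin m → K),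
      (∀ x y z : Fin m → K, mulS (mulS x y) z = mulS x (mulS y z)) ∧
      (∀ x : Fin m → K, mulS oneS x = x) ∧ (∀ x : Fin m → K, mulS x oneS = x) ∧
      ∃ c : RingCon A.Elt, Finite c.Quotient ∧
      ∃ φ : A.Elt → Fin m → K,
        (∀ x y : A.Elt, φ (x + y) = φ x + φ y) ∧
        (∀ x y : A.Elt, φ (x * y) = mulS (φ x) (φ y)) ∧
        φ 1 = oneS ∧
        Function.Bijective (fun x : A.Elt => (φ x, c.mk' x)) ∧
        (∃ P : Fin m → MvPolynomial (Fin A.n) K,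
          ∀ x : A.Elt, ∀ i, φ x i = MvPolynomial.eval x.1 (P i)) ∧
        (∀ q : c.Quotient, ∃ Q : Fin A.n → MvPolynomial (Fin m) K,
          ∀ x : A.Elt, c.mk' x = q → ∀ i, x.1 i = MvPolynomial.eval (φ x) (Q i)) := by
  obtain ⟨m, N, φ, hN, hadd, hsurj, hker, hreg, hpar, hinv, T, _, f, hf⟩ :=
    AlgRingAux.structure_thm A
  have hNK : (N : K) ≠ 0 := Nat.cast_ne_zero.2 hN.ne'
  have h0 : φ 0 = 0 := (hker 0).2 (smul_zero N)
  have hnsmul : ∀ (n : ℕ) z, φ (n • z) = (n : K) • φ z := by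
    intro n z
    induction n with
    | zero => simp [h0]
    | succ n ih => rw [succ_nsmul, hadd, ih, Nat.cast_succ, add_smul, one_smul]
  have hsub : ∀ a b, φ (a - b) = φ a - φ b := by
    intro a b
    rw [eq_sub_iff_add_eq, ← hadd, sub_add_cancel]
  have hmulr : ∀ a a' b, φ a = φ a' → φ (a * b) = φ (a' * b) := by
    intro a a' b h
    rw [← sub_eq_zero, ← hsub, ← sub_mul, hker, ← smul_mul_assoc,
      (hker (a - a')).1 (by rw [hsub, h, sub_self]), zero_mul]
  have hmull : ∀ a b b', φ b = φ b' → φ (a * b) = φ (a * b') := by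
    intro a b b' h
    rw [← sub_eq_zero, ← hsub, ← mul_sub, hker, ← mul_smul_comm,
      (hker (b - b')).1 (by rw [hsub, h, sub_self]), mul_zero]
  have hsmulr : ∀ (c : K) a b a', φ a' = c • φ a → φ (a' * b) = c • φ (a * b) := by
    intro c a b a' h
    obtain ⟨p, hp1, hp2, hp3⟩ := hpar a
    have key : ∀ t : K, φ (p t * b) = (N * t) • φ (a * b) := by
      intro t
      funext i
      have h1 : (fun t => φ (p t * b) i) ∈ AlgRingAux.lineFun K :=
        AlgRingAux.comp_mem _ p hp1 (AlgRingAux.mul_right_mem b (hreg i))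
      have h2 : (fun t : K => t) ∈ AlgRingAux.lineFun K := AlgRingAux.id_mem_lineFun
      have h3 := AlgRingAux.line_vanish ((AlgRingAux.lineFun K).sub_mem h1
        ((AlgRingAux.lineFun K).smul_mem h2 (N * φ (a * b) i))) (fun n => by
          simp only [Pi.sub_apply, Pi.smul_apply, hp3, smul_mul_assoc, hnsmul, smul_eq_mul]
          push_cast
          ring) t
      simp only [Pi.sub_apply, Pi.smul_apply, smul_eq_mul] at h3 ⊢
      rw [sub_eq_zero] at h3
      rw [h3]
      ring
    rw [hmulr a' (p ((N : K)⁻¹ * c)) b (by rw [h, hp2, mul_inv_cancel_left₀ hNK]), key,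
      mul_inv_cancel_left₀ hNK]
  have hsmull : ∀ (c : K) a b b', φ b' = c • φ b → φ (a * b') = c • φ (a * b) := by
    intro c a b b' h
    obtain ⟨p, hp1, hp2, hp3⟩ := hpar b
    have key : ∀ t : K, φ (a * p t) = (N * t) • φ (a * b) := by
      intro t
      funext i
      have h1 : (fun t => φ (a * p t) i) ∈ AlgRingAux.lineFun K :=
        AlgRingAux.comp_mem _ p hp1 (AlgRingAux.mul_left_mem a (hreg i))
      have h2 : (fun t : K => t) ∈ AlgRingAux.lineFun K := AlgRingAux.id_mem_lineFun
      have h3 := AlgRingAux.line_vanish ((AlgRingAux.lineFun K).sub_mem h1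
        ((AlgRingAux.lineFun K).smul_mem h2 (N * φ (a * b) i))) (fun n => by
          simp only [Pi.sub_apply, Pi.smul_apply, hp3, mul_smul_comm, hnsmul, smul_eq_mul]
          push_cast
          ring) t
      simp only [Pi.sub_apply, Pi.smul_apply, smul_eq_mul] at h3 ⊢
      rw [sub_eq_zero] at h3
      rw [h3]
      ring
    rw [hmull a b' (p ((N : K)⁻¹ * c)) (by rw [h, hp2, mul_inv_cancel_left₀ hNK]), key,
      mul_inv_cancel_left₀ hNK]
  choose s hs using hsurj
  let mulS : (Fin m → K) →ₗ[K] (Fin m → K) →ₗ[K] (Fin m → K) :=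
    LinearMap.mk₂ K (fun v w => φ (s v * s w))
      (fun v v' w => by
        rw [← hadd, ← add_mul]
        exact hmulr _ _ _ (by rw [hadd, hs, hs, hs]))
      (fun c v w => hsmulr c _ _ _ (by rw [hs, hs]))
      (fun v w w' => by
        rw [← hadd, ← mul_add]
        exact hmull _ _ _ (by rw [hadd, hs, hs, hs]))
      (fun c v w => hsmull c _ _ _ (by rw [hs, hs]))
  have hmulS : ∀ a b, mulS (φ a) (φ b) = φ (a * b) := by
    intro a b
    show φ (s (φ a) * s (φ b)) = _
    rw [hmulr _ a _ (hs _), hmull _ _ b (hs _)]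
  let c : RingCon A.Elt :=
    { r := fun x y => ∃ z, x = y + N • z
      iseqv :=
        ⟨fun x => ⟨0, by simp⟩,
         fun {x y} ⟨z, hz⟩ => ⟨-z, by rw [hz]; simp⟩,
         fun {x y w} ⟨z, hz⟩ ⟨z', hz'⟩ => ⟨z' + z, by rw [hz, hz', smul_add, add_assoc]⟩⟩
      mul' := by
        rintro x x' y y' ⟨z, rfl⟩ ⟨z', rfl⟩
        refine ⟨x' * z' + z * y' + N • (z * z'), ?_⟩
        simp only [add_mul, mul_add, smul_mul_assoc, mul_smul_comm, smul_add]
        abel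
      add' := by
        rintro x x' y y' ⟨z, rfl⟩ ⟨z', rfl⟩
        refine ⟨z + z', ?_⟩
        rw [smul_add]
        abel }
  have hc : ∀ x y, c.mk' x = c.mk' y ↔ ∃ z, x = y + N • z := fun x y => RingCon.eq c
  refine ⟨m, mulS, φ 1, ?_, ?_, ?_, c, ?_, φ, hadd, fun x y => (hmulS x y).symm, rfl, ?_, ?_, ?_⟩
  · intro x y z
    rw [← hs x, ← hs y, ← hs z]
    simp only [hmulS, mul_assoc]
  · intro x
    rw [← hs x, hmulS, one_mul]
  · intro x
    rw [← hs x, hmulS, mul_one]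
  · choose r hr using c.mk'_surjective
    refine Finite.of_injective (fun q => f (r q)) fun q q' h => ?_
    rw [← hr q, ← hr q', hc]
    exact hf _ _ h
  · constructor
    · intro x y h
      have h1 : φ x = φ y := congrArg Prod.fst h
      obtain ⟨z, rfl⟩ := (hc x y).1 (congrArg Prod.snd h)
      have h2 : φ z = 0 := by
        rw [hadd, hnsmul] at h1
        have h3 : (N : K) • φ z = 0 := by simpa using h1
        exact (smul_eq_zero.1 h3).resolve_left hNK
      rw [(hker z).1 h2, add_zero]
    · rintro ⟨v, q⟩
      obtain ⟨b, rfl⟩ := c.mk'_surjective q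
      refine ⟨b + N • s ((N : K)⁻¹ • (v - φ b)), Prod.ext ?_ ?_⟩
      · show φ _ = v
        rw [hadd, hnsmul, hs, smul_smul, mul_inv_cancel₀ hNK, one_smul, add_sub_cancel]
      · exact (hc _ _).2 ⟨_, rfl⟩
  · choose P hP using fun i => AlgRingAux.mem_regFun.1 (hreg i)
    exact ⟨P, fun x i => hP i x⟩
  · intro q
    obtain ⟨b, rfl⟩ := c.mk'_surjective q
    obtain ⟨Q, hQ⟩ := hinv b
    refine ⟨Q, fun x hx i => ?_⟩
    obtain ⟨z, rfl⟩ := (hc _ _).1 hx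
    exact hQ z i
end

section
/- Let $(A, \alpha, \mu)$ be a one-dimensional connected commutative algebraic ring over an algebraically closed field $K$. Then $(A, \alpha, \mu)$ is isomorphic as an algebraic ring to $(K, +, \cdot)$. -/
section
open Polynomial

theorem AR.exists_point {K T : Type} [Field K] [IsAlgClosed K] [CommRing T] [Algebra K T]
    [Algebra.FiniteType K T] (M : Ideal T) [hM : M.IsMaximal] :
    ∃ χ : T →ₐ[K] K, ∀ t, χ t = 0 ↔ t ∈ M := by
  let _ : Field (T ⧸ M) := Ideal.Quotient.field M
  have : Module.Finite K (T ⧸ M) := finite_of_finite_type_of_isJacobsonRing K (T ⧸ M)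
  have hb := IsAlgClosed.algebraMap_bijective_of_isIntegral (k := K) (K := T ⧸ M)
  let e := AlgEquiv.ofBijective (Algebra.ofId K (T ⧸ M)) hb
  refine ⟨(e.symm : (T ⧸ M) →ₐ[K] K).comp (Ideal.Quotient.mkₐ K M), fun t => ?_⟩
  simp [Ideal.Quotient.eq_zero_iff_mem]

theorem AR.nilp_of_points {K T : Type} [Field K] [IsAlgClosed K] [CommRing T] [Algebra K T]
    [Algebra.FiniteType K T] (t : T) (h : ∀ χ : T →ₐ[K] K, χ t = 0) : IsNilpotent t := by
  have : IsJacobsonRing T := isJacobsonRing_of_finiteType (A := K) 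
  have h1 : t ∈ (⊥ : Ideal T).jacobson := by
    rw [Ideal.mem_jacobson_bot, ] 
    intro y
    by_contra hu
    obtain ⟨M, hM, hm⟩ := exists_max_ideal_of_mem_nonunits hu
    obtain ⟨χ, hχ⟩ := AR.exists_point (K := K) M
    have := (hχ _).2 hm
    simp [h] at this
  have h2 : (⊥ : Ideal T).radical.jacobson = (⊥ : Ideal T).radical :=
    IsJacobsonRing.out inferInstance (Ideal.radical_isRadical _)
  have h3 : t ∈ (⊥ : Ideal T).radical := by
    rw [← h2]; exact Ideal.jacobson_mono (Ideal.le_radical) h1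
  exact mem_nilradical.1 h3

theorem AR.unit_of_points {K T : Type} [Field K] [IsAlgClosed K] [CommRing T] [Algebra K T]
    [Algebra.FiniteType K T] (t : T) (h : ∀ χ : T →ₐ[K] K, χ t ≠ 0) : IsUnit t := by
  by_contra hu
  obtain ⟨M, hM, hm⟩ := exists_max_ideal_of_mem_nonunits hu
  obtain ⟨χ, hχ⟩ := AR.exists_point (K := K) M
  exact h χ ((hχ _).2 hm)

theorem AR.two_le_of_trdeg {K R : Type} [Field K] [CommRing R] [IsDomain R] [Algebra K R]
    [Algebra.FiniteType K R] (h : 1 < Algebra.trdeg K R) : 2 ≤ ringKrullDim R := by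
  obtain ⟨s, g, hg, hint⟩ := exists_integral_inj_algHom_of_fg K R
  let _ : Algebra (MvPolynomial (Fin s) K) R := g.toRingHom.toAlgebra
  have : IsScalarTower K (MvPolynomial (Fin s) K) R := IsScalarTower.of_algHom g
  have : Algebra.IsIntegral (MvPolynomial (Fin s) K) R := ⟨hint⟩
  have : FaithfulSMul (MvPolynomial (Fin s) K) R := (faithfulSMul_iff_algebraMap_injective _ _).2 hg
  have htr : Algebra.trdeg K R = s := by
    have := trdeg_add_eq K (MvPolynomial (Fin s) K) (A := R)
    rw [← this]
    simp [trdeg_eq_zero]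
  have hs : 1 < s := by rw [htr] at h; exact_mod_cast h
  let i0 : Fin s := ⟨0, by omega⟩
  let i1 : Fin s := ⟨1, by omega⟩
  let e1 : MvPolynomial (Fin s) K →ₐ[K] K[X] := MvPolynomial.aeval (fun i => if i = i0 then 0 else X)
  let e2 : MvPolynomial (Fin s) K →ₐ[K] K := (Polynomial.aeval 0).comp e1
  let P1 := RingHom.ker e1
  let P2 := RingHom.ker e2
  have : P1.IsPrime := RingHom.ker_isPrime _
  have : P2.IsPrime := RingHom.ker_isPrime _
  have hP : P1 ≤ P2 := by
    intro x hx
    have : e1 x = 0 := hx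
    show (Polynomial.aeval 0) (e1 x) = 0
    rw [this, map_zero]
  obtain ⟨Q1, -, hQ1, hc1⟩ := Ideal.exists_ideal_over_prime_of_isIntegral P1 (⊥ : Ideal R) (by
    rw [← RingHom.ker_eq_comap_bot, (RingHom.injective_iff_ker_eq_bot (algebraMap (MvPolynomial (Fin s) K) R)).1 hg]; exact bot_le)
  obtain ⟨Q2, hle, hQ2, hc2⟩ := Ideal.exists_ideal_over_prime_of_isIntegral P2 Q1 (by rw [hc1]; exact hP)
  have n1 : Q1 ≠ ⊥ := by
    rintro rfl
    have : (MvPolynomial.X i0 : MvPolynomial (Fin s) K) ∈ P1 := by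
      show e1 _ = 0
      simp [e1]
    rw [← hc1, Ideal.mem_comap, Ideal.mem_bot] at this
    have h2 := hg (this.trans (map_zero g).symm)
    exact MvPolynomial.X_ne_zero _ h2
  have n2 : Q1 ≠ Q2 := by
    rintro rfl
    have h2 : (MvPolynomial.X i1 : MvPolynomial (Fin s) K) ∈ P2 := by
      show (Polynomial.aeval 0) (e1 _) = 0
      simp [e1, i0, i1]
    rw [← hc2, hc1] at h2
    have : e1 (MvPolynomial.X i1) = 0 := h2
    simp [e1, i0, i1] at this
  let l : LTSeries (PrimeSpectrum R) := ((RelSeries.singleton _ (⟨⊥, Ideal.isPrime_bot⟩ : PrimeSpectrum R)).snoc ⟨Q1, hQ1⟩ (by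
    show (⊥ : Ideal R) < Q1
    exact bot_lt_iff_ne_bot.2 n1)).snoc ⟨Q2, hQ2⟩ (by
      rw [RelSeries.last_snoc]
      show Q1 < Q2
      exact lt_of_le_of_ne hle n2)
  exact Order.LTSeries.length_le_krullDim l


theorem AR.algebraic_of_trdeg {K R : Type} [Field K] [CommRing R] [IsDomain R] [Algebra K R]
    [Algebra K[X] R] [IsScalarTower K K[X] R] [FaithfulSMul K[X] R]
    (h : Algebra.trdeg K R ≤ 1) : Algebra.IsAlgebraic K[X] R := by
  rw [← trdeg_eq_zero_iff]
  have := trdeg_add_eq K K[X] (A := R)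
  rw [Polynomial.trdeg_of_isDomain] at this
  rw [← this] at h
  have h2 : Algebra.trdeg K[X] R < Cardinal.aleph0 :=
    lt_of_le_of_lt (le_trans (self_le_add_left _ _) h) Cardinal.one_lt_aleph0
  obtain ⟨n, hn⟩ := Cardinal.lt_aleph0.1 h2
  rw [hn] at h ⊢
  have : 1 + n ≤ 1 := by exact_mod_cast h
  have : n = 0 := by omega
  simp [this]

theorem AR.exists_denom {K R : Type} [Field K] [CommRing R] [IsDomain R] [Algebra K R]
    [Algebra K[X] R] [IsScalarTower K K[X] R] [FaithfulSMul K[X] R] [Algebra.FiniteType K R]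
    [Algebra.IsAlgebraic K[X] R] :
    ∃ h : K[X], h ≠ 0 ∧ ∀ r : R, ∃ N : ℕ, IsIntegral K[X] (h ^ N • r) := by
  obtain ⟨s, hs⟩ := (inferInstance : Algebra.FiniteType K R).out
  have h1 : ∀ r : R, ∃ y : K[X], y ≠ 0 ∧ IsIntegral K[X] (y • r) := fun r =>
    (Algebra.IsAlgebraic.isAlgebraic (R := K[X]) r).exists_integral_multiple
  choose y hy0 hy using h1
  have hint : ∀ (N : ℕ) (h : K[X]) (r : R), IsIntegral K[X] r → IsIntegral K[X] (h ^ N • r) := by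
    intro N h r hr
    exact hr.smul _
  refine ⟨∏ r ∈ s, y r, Finset.prod_ne_zero_iff.2 fun r _ => hy0 r, fun r => ?_⟩
  have hr : r ∈ Algebra.adjoin K (s : Set R) := by rw [hs]; trivial
  induction hr using Algebra.adjoin_induction with
  | mem x hx =>
    refine ⟨1, ?_⟩
    obtain ⟨d, hd⟩ := Finset.dvd_prod_of_mem y hx
    rw [pow_one, hd, mul_comm, mul_smul]
    exact (hy x).smul _
  | algebraMap k =>
    refine ⟨0, ?_⟩
    rw [pow_zero, one_smul, IsScalarTower.algebraMap_apply K K[X] R]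
    exact isIntegral_algebraMap
  | add x z _ _ hx hz =>
    obtain ⟨N, hN⟩ := hx
    obtain ⟨M, hM⟩ := hz
    refine ⟨N + M, ?_⟩
    rw [smul_add]
    refine IsIntegral.add ?_ ?_
    · rw [add_comm, pow_add, mul_smul]; exact hN.smul _
    · rw [pow_add, mul_smul]; exact hM.smul _
  | mul x z _ _ hx hz =>
    obtain ⟨N, hN⟩ := hx
    obtain ⟨M, hM⟩ := hz
    refine ⟨N + M, ?_⟩
    rw [pow_add, ← smul_mul_smul_comm]
    exact hN.mul hM

theorem AR.unit_finite {K R : Type} [Field K] [CommRing R] [IsDomain R] [Algebra K R]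
    [Algebra K[X] R] [IsScalarTower K K[X] R] [FaithfulSMul K[X] R] [Algebra.FiniteType K R]
    [Algebra.IsAlgebraic K[X] R] :
    ∃ h : K[X], h ≠ 0 ∧ ∀ c : K, IsUnit (algebraMap K[X] R (X - C c)) → h.eval c = 0 := by
  obtain ⟨h, h0, hh⟩ := AR.exists_denom (K := K) (R := R)
  refine ⟨h, h0, fun c hc => ?_⟩
  obtain ⟨v, hv⟩ := hc.exists_right_inv
  obtain ⟨N, hN⟩ := hh v
  let P : Ideal K[X] := RingHom.ker (Polynomial.evalRingHom c)
  have : P.IsPrime := RingHom.ker_isPrime _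
  obtain ⟨Q, -, hQ, hQc⟩ := Ideal.exists_ideal_over_prime_of_isIntegral
    (S := integralClosure K[X] R) P ⊥ (by
      rw [← RingHom.ker_eq_comap_bot]
      intro a ha
      have h1 : algebraMap K[X] (integralClosure K[X] R) a = 0 := ha
      have h2 : algebraMap K[X] R a = 0 := congrArg Subtype.val h1
      have h3 := FaithfulSMul.algebraMap_injective K[X] R (h2.trans (map_zero _).symm)
      rw [h3]; exact P.zero_mem)
  let w : integralClosure K[X] R := ⟨h ^ N • v, hN⟩
  have hw : algebraMap K[X] (integralClosure K[X] R) (X - C c) * w =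
      algebraMap K[X] (integralClosure K[X] R) (h ^ N) := by
    apply Subtype.ext
    show algebraMap K[X] R (X - C c) * (h ^ N • v) = algebraMap K[X] R (h ^ N)
    rw [mul_smul_comm, hv, Algebra.algebraMap_eq_smul_one]
  have hX : (X - C c) ∈ Q.comap (algebraMap K[X] (integralClosure K[X] R)) := by
    rw [hQc]; simp [P, RingHom.mem_ker]
  have : h ^ N ∈ Q.comap (algebraMap K[X] (integralClosure K[X] R)) := by
    rw [Ideal.mem_comap, ← hw]
    exact Q.mul_mem_right _ hX
  rw [hQc] at this
  have h2 : (h ^ N).eval c = 0 := this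
  rw [eval_pow] at h2
  exact eq_zero_of_pow_eq_zero h2

theorem AR.fibre {K R : Type} [Field K] [CommRing R] [IsDomain R] [Algebra K R]
    [Algebra K[X] R] [IsScalarTower K K[X] R] [FaithfulSMul K[X] R]
    [Algebra.IsAlgebraic K[X] R] (r : R) (c : K) :
    ∃ p : K[X], p ≠ 0 ∧ ∀ χ : R →ₐ[K] K, χ (algebraMap K[X] R X) = c → p.eval (χ r) = 0 := by
  classical
  obtain ⟨P, hP0, hP⟩ := Algebra.IsAlgebraic.isAlgebraic (R := K[X]) r
  let _ : NormalizedGCDMonoid K[X] := Classical.choice inferInstance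
  have h1 : aeval r P.primPart = 0 := Polynomial.aeval_primPart_eq_zero hP0 hP
  refine ⟨P.primPart.map (evalRingHom c), fun h0 => ?_, fun χ hχ => ?_⟩
  · have : C (X - C c) ∣ P.primPart := by
      rw [Polynomial.C_dvd_iff_dvd_coeff]
      intro i
      rw [dvd_iff_isRoot]
      have := congrArg (fun q => Polynomial.coeff q i) h0
      simpa using this
    exact not_isUnit_X_sub_C c (P.isPrimitive_primPart _ this)
  · have hcomp : (χ : R →+* K).comp (algebraMap K[X] R) = evalRingHom c := by
      apply Polynomial.ringHom_ext
      · intro a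
        have : algebraMap K[X] R (C a) = algebraMap K R a :=
          (IsScalarTower.algebraMap_apply K K[X] R a).symm
        simp [this]
      · simpa using hχ
    have h2 := congrArg (χ : R →+* K) h1
    rw [aeval_def, Polynomial.hom_eval₂, hcomp, map_zero] at h2
    rw [eval_map]
    exact h2

theorem AR.insep {K R : Type} [Field K] [IsAlgClosed K] [CommRing R] [IsDomain R] [Algebra K R]
    [Algebra K[X] R] [IsScalarTower K K[X] R] [FaithfulSMul K[X] R] [Algebra.FiniteType K R]
    [Algebra.IsAlgebraic K[X] R] (p : ℕ) [ExpChar K p]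
    (hinj : ∀ χ χ' : R →ₐ[K] K, χ (algebraMap K[X] R X) = χ' (algebraMap K[X] R X) → χ = χ')
    (r : R) : ∃ (n : ℕ) (g h : K[X]), IsCoprime g h ∧
      r ^ p ^ n * algebraMap K[X] R h = algebraMap K[X] R g := by
  let T := TensorProduct K[X] R R
  have : Algebra.FiniteType K[X] R := Algebra.FiniteType.of_restrictScalars_finiteType K K[X] R
  have : Algebra.FiniteType K T := 
    Algebra.FiniteType.trans (S := R) inferInstance inferInstance
  have hnil : ∀ f : R, IsNilpotent (f ⊗ₜ[K[X]] (1 : R) - (1 : R) ⊗ₜ[K[X]] f : T) := by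
    intro f
    apply AR.nilp_of_points (K := K)
    intro χ
    let il : R →ₐ[K] T := (Algebra.TensorProduct.includeLeft : R →ₐ[K[X]] T).restrictScalars K
    let ir : R →ₐ[K] T := (Algebra.TensorProduct.includeRight : R →ₐ[K[X]] T).restrictScalars K
    have h := hinj (χ.comp il) (χ.comp ir) (by
      have : il (algebraMap K[X] R X) = ir (algebraMap K[X] R X) := by
        simp [il, ir]
      simp only [AlgHom.comp_apply, this])
    rw [map_sub, sub_eq_zero]
    exact DFunLike.congr_fun h f
  let F := FractionRing K[X]
  let L := FractionRing R
  have : FaithfulSMul K[X] L := by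
    rw [faithfulSMul_iff_algebraMap_injective, IsScalarTower.algebraMap_eq K[X] R L]
    exact (IsFractionRing.injective R L).comp (FaithfulSMul.algebraMap_injective K[X] R)
  let _ : Algebra F L := FractionRing.liftAlgebra K[X] L
  have : IsScalarTower K[X] F L := FractionRing.isScalarTower_liftAlgebra K[X] L
  have : Algebra.IsAlgebraic F L := by
    have h1 : Algebra.IsAlgebraic R L := IsLocalization.isAlgebraic _ (nonZeroDivisors R)
    have h2 : Algebra.IsAlgebraic K[X] L := Algebra.IsAlgebraic.trans K[X] R L
    exact Algebra.IsAlgebraic.extendScalars (R := K[X]) (IsFractionRing.injective K[X] F)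
  have hpi : IsPurelyInseparable F L := by
    rw [isPurelyInseparable_iff_subsingleton_emb]
    refine ⟨fun σ τ => ?_⟩
    let σ' : L →ₐ[K[X]] AlgebraicClosure L := AlgHom.restrictScalars K[X] σ
    let τ' : L →ₐ[K[X]] AlgebraicClosure L := AlgHom.restrictScalars K[X] τ
    have key : ∀ f : R, σ (algebraMap R L f) = τ (algebraMap R L f) := by
      intro f
      let ι : R →ₐ[K[X]] L := IsScalarTower.toAlgHom K[X] R L
      let m : T →ₐ[K[X]] AlgebraicClosure L :=
        Algebra.TensorProduct.productMap (σ'.comp ι) (τ'.comp ι)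
      have h := (hnil f).map m
      rw [isNilpotent_iff_eq_zero, map_sub, sub_eq_zero] at h
      have e1 : m (f ⊗ₜ[K[X]] (1 : R)) = σ' (ι f) * τ' (ι 1) :=
        Algebra.TensorProduct.productMap_apply_tmul _ _ _ _
      have e2 : m ((1 : R) ⊗ₜ[K[X]] f) = σ' (ι 1) * τ' (ι f) :=
        Algebra.TensorProduct.productMap_apply_tmul _ _ _ _
      rw [map_one, map_one, mul_one] at e1
      rw [map_one, map_one, one_mul] at e2
      exact e1.symm.trans (h.trans e2)
    have hr : (σ : L →+* AlgebraicClosure L) = (τ : L →+* AlgebraicClosure L) := by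
      apply IsLocalization.ringHom_ext (nonZeroDivisors R)
      ext f
      exact key f
    ext x
    exact DFunLike.congr_fun hr x
  have : ExpChar F p := expChar_of_injective_algebraMap (algebraMap K F).injective p
  obtain ⟨n, y, hy⟩ := (isPurelyInseparable_iff_pow_mem F p).1 hpi (algebraMap R L r)
  refine ⟨n, IsFractionRing.num K[X] y, IsFractionRing.den K[X] y, ?_, ?_⟩
  · exact (IsFractionRing.num_den_reduced K[X] y).isCoprime
  · apply IsFractionRing.injective R L
    have h1 : algebraMap K[X] F (IsFractionRing.num K[X] y) =
      y * algebraMap K[X] F (IsFractionRing.den K[X] y : K[X]) := by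
      have := IsFractionRing.mk'_num_den K[X] y
      rw [IsLocalization.mk'_eq_iff_eq_mul] at this
      exact this
    have h2 := congrArg (algebraMap F L) h1
    rw [map_mul, hy, ← IsScalarTower.algebraMap_apply, ← IsScalarTower.algebraMap_apply] at h2
    rw [map_mul, map_pow, ← IsScalarTower.algebraMap_apply, ← IsScalarTower.algebraMap_apply, h2]

theorem AR.monomial_mem {K : Type} [Field K] [Infinite K] (W : Submodule K K[X])
    (hW : ∀ g ∈ W, ∀ a : K, g.comp (C a * X) ∈ W) (g : K[X]) (hg : g ∈ W) (m : ℕ)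
    (hm : g.coeff m ≠ 0) : X ^ m ∈ W := by
  by_contra hX
  obtain ⟨l, hl, hlW⟩ := Submodule.exists_le_ker_of_notMem hX
  let q : K[X] := ∑ i ∈ g.support, monomial i (g.coeff i * l (X ^ i))
  have hq : q = 0 := by
    apply Polynomial.funext
    intro a
    have h1 : l (g.comp (C a * X)) = 0 := hlW (hW g hg a)
    rw [comp, eval₂_eq_sum, sum_def, map_sum] at h1
    rw [eval_zero, ← h1, eval_finsetSum]
    refine Finset.sum_congr rfl fun i _ => ?_
    rw [eval_monomial, mul_pow, ← C_pow, ← mul_assoc, ← C_mul, ← smul_eq_C_mul, map_smul,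
      smul_eq_mul]
    ring
  have h2 : q.coeff m = g.coeff m * l (X ^ m) := by
    simp only [q, finsetSum_coeff, coeff_monomial]
    rw [Finset.sum_ite_eq' g.support m, if_pos (mem_support_iff.2 hm)]
  rw [hq, coeff_zero] at h2
  exact (mul_ne_zero hm hl) h2.symm

theorem AR.subalgebra_poly {K : Type} [Field K] [Infinite K] (p : ℕ) [ExpChar K p]
    (W : Subalgebra K K[X])
    (hW : ∀ g ∈ W, ∀ a b : K, g.comp (C a * X + C b) ∈ W) (n : ℕ) (hn : X ^ p ^ n ∈ W) :
    ∃ e : ℕ, X ^ p ^ e ∈ W ∧ ∀ g ∈ W, ∃ Q : K[X], g = Q.comp (X ^ p ^ e) := by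
  classical
  have hex : ∃ e : ℕ, (X ^ p ^ e : K[X]) ∈ W := ⟨n, hn⟩
  refine ⟨Nat.find hex, Nat.find_spec hex, fun g hg => ?_⟩
  set e := Nat.find hex with he
  have hmon : ∀ g ∈ W, ∀ m, g.coeff m ≠ 0 → (X ^ m : K[X]) ∈ W := fun g hg m hm =>
    AR.monomial_mem (Subalgebra.toSubmodule W) (fun g hg a => by
      have := hW g hg a 0
      simpa using this) g hg m hm
  have hdvd : ∀ m, g.coeff m ≠ 0 → p ^ e ∣ m := by
    intro m hm
    have hXm := hmon g hg m hm
    rcases Nat.eq_zero_or_pos m with rfl | hm0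
    · exact dvd_zero _
    rcases (inferInstance : ExpChar K p) with _ | hp
    · simp
    · obtain ⟨k, m', hm', rfl⟩ := Nat.exists_eq_pow_mul_and_not_dvd hm0.ne' p hp.ne_one
      have := Fact.mk hp
      have h1 := hW _ hXm 1 1
      have h2 : (X ^ (p ^ k * m') : K[X]).comp (C 1 * X + C 1) = expand K (p ^ k) ((X + 1) ^ m') := by
        simp [pow_mul, add_pow_char_pow]
      rw [h2] at h1
      have h3 := hmon _ h1 (1 * p ^ k) (by
        rw [coeff_expand_mul (pow_pos hp.pos k)]
        rw [coeff_X_add_one_pow, Nat.choose_one_right]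
        intro h
        exact hm' ((CharP.cast_eq_zero_iff K p m').1 h))
      rw [one_mul] at h3
      have : e ≤ k := Nat.find_min' hex h3
      exact (pow_dvd_pow p this).mul_right _
  have hpos : 0 < p ^ e := pow_pos (expChar_pos K p) e
  refine ⟨contract (p ^ e) g, ?_⟩
  rw [← expand_eq_comp_X_pow]
  ext m
  rw [coeff_expand hpos]
  split_ifs with hd
  · rw [coeff_contract hpos.ne', Nat.div_mul_cancel hd]
  · by_contra hc
    exact hd (hdvd m hc)

def AR.HasComul {K X R : Type} [Field K] [CommRing R] [Algebra K R] (E : R →ₐ[K] (X → K))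
    (op : X → X → X) : Prop :=
  ∀ f : R, ∃ (ι : Type) (s : Finset ι) (g h : ι → R),
    ∀ x y, E f (op x y) = ∑ i ∈ s, E (g i) x * E (h i) y

theorem AR.HasComul.right {K X R : Type} [Field K] [CommRing R] [Algebra K R]
    {E : R →ₐ[K] (X → K)} {op : X → X → X}
    (H : AR.HasComul E op) (a : X) (f : R) : ∃ f' : R, ∀ x, E f' x = E f (op a x) := by
  obtain ⟨ι, s, g, h, hh⟩ := H f
  refine ⟨∑ i ∈ s, E (g i) a • h i, fun x => ?_⟩
  rw [hh]
  simp

theorem AR.functional_mem {K X V R : Type} [Field K] [CommRing R] [Algebra K R]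
    (E : R →ₐ[K] (X → K))
    [AddCommGroup V] [Module K V] [Module.Finite K V] (ρ : X → Module.End K V)
    (hρ : ∀ (l : V →ₗ[K] K) (v : V), ∃ f : R, ∀ a, E f a = l (ρ a v))
    (l : Module.End K V →ₗ[K] K) :
    ∃ f : R, ∀ a, E f a = l (ρ a) := by
  classical
  let b := Module.finBasis K V
  choose F hF using hρ
  refine ⟨∑ ij, l (b.end ij) • F (b.coord ij.1) (b ij.2), fun a => ?_⟩
  conv_rhs => rw [← b.end.sum_repr (ρ a), map_sum]
  rw [map_sum, Finset.sum_apply]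
  refine Finset.sum_congr rfl fun ij _ => ?_
  rw [map_smul, map_smul, Pi.smul_apply, smul_eq_mul, smul_eq_mul, mul_comm, hF]
  congr 1
  have : b.end.repr (ρ a) ij = LinearMap.toMatrix b b (ρ a) ij.1 ij.2 := rfl
  rw [this, LinearMap.toMatrix_apply]
  rfl

theorem AR.char_of_rep {K X V : Type} [Field K] [IsAlgClosed K] [CommRing X]
    [AddCommGroup V] [Module K V] [Module.Finite K V] [Nontrivial V] (ρ : X →+* Module.End K V) :
    ∃ (ψ : X →+* K) (l : Module.End K V →ₗ[K] K), ∀ a, ψ a = l (ρ a) := by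
  let B := Algebra.adjoin K (Set.range ρ)
  have hcm : IsMulCommutative B := Algebra.isMulCommutative_adjoin K (by
    rintro _ ⟨a, rfl⟩ _ ⟨b, rfl⟩
    rw [← map_mul, mul_comm, map_mul])
  let _ : CommRing B := { (inferInstance : Ring B) with mul_comm := hcm.is_comm.comm }
  have : Nontrivial B := inferInstance
  have : Module.Finite K B := inferInstanceAs (Module.Finite K (Subalgebra.toSubmodule B))
  obtain ⟨M, hM⟩ := Ideal.exists_maximal B
  have : Algebra.FiniteType K B := inferInstance
  obtain ⟨χ, -⟩ := AR.exists_point (K := K) M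
  obtain ⟨l, hl⟩ := LinearMap.exists_extend (p := Subalgebra.toSubmodule B) χ.toLinearMap
  let ρ' : X →+* B := ρ.codRestrict B (fun a => Algebra.subset_adjoin ⟨a, rfl⟩)
  refine ⟨(χ : B →+* K).comp ρ', l, fun a => ?_⟩
  have := LinearMap.congr_fun hl (ρ' a)
  exact this.symm

theorem AR.exists_char {K X R : Type} [Field K] [IsAlgClosed K] [CommRing X] [Nontrivial X]
    [CommRing R] [Algebra K R] (E : R →ₐ[K] (X → K)) (hE : Function.Injective E)
    [IsDomain R] [Algebra.FiniteType K R]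
    (hadd : AR.HasComul E (· + ·)) (hmul : AR.HasComul E (· * ·))
    (hsep : ∀ x y : X, (∀ f, E f x = E f y) → x = y) :
    ∃ (ψ : X →+* K) (f : R), ∀ a, E f a = ψ a := by
  classical
  have hEx : ∀ f g : R, (∀ x, E f x = E g x) → f = g := fun f g h => hE (funext h)
  have : IsNoetherianRing R := Algebra.FiniteType.isNoetherianRing K R
  let ev : R →ₐ[K] K := (Pi.evalAlgHom K (fun _ : X => K) 0).comp E
  let m : Ideal R := RingHom.ker ev
  have hmem : ∀ f : R, f ∈ m ↔ E f 0 = 0 := fun f => Iff.rfl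
  choose la hla using hmul.right
  have hcst : ∀ (k : K) x, E (algebraMap K R k) x = k := by
    intro k x
    rw [AlgHom.commutes]; rfl
  let La : X → (R →ₐ[K] R) := fun a =>
    { toFun := la a
      map_one' := hEx _ _ fun x => by rw [hla]; simp
      map_mul' := fun _ _ => hEx _ _ fun x => by simp [hla]
      map_zero' := hEx _ _ fun x => by rw [hla]; simp
      map_add' := fun _ _ => hEx _ _ fun x => by simp [hla]
      commutes' := fun _ => hEx _ _ fun x => by rw [hla, hcst, hcst] }
  have hLE : ∀ a f x, E (La a f) x = E f (a * x) := fun a f x => hla a f x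
  have hLa : ∀ a, m ≤ m.comap (La a) := by
    intro a f hf
    rw [Ideal.mem_comap, hmem, hLE, mul_zero]
    exact hf
  clear_value La
  let r : X → Module.End K m.Cotangent := fun a => Ideal.mapCotangent m m (La a) (hLa a)
  have hr : ∀ a (f : m), r a (m.toCotangent f) = m.toCotangent ⟨La a f.1, hLa a f.2⟩ := fun a f =>
    Ideal.mapCotangent_toCotangent _ _ _ _ _
  clear_value r
  have hext : ∀ S T : Module.End K m.Cotangent,
      (∀ f : m, S (m.toCotangent f) = T (m.toCotangent f)) → S = T := by
    intro S T h
    ext v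
    obtain ⟨f, rfl⟩ := m.toCotangent_surjective v
    exact h f
  have hz : ∀ f : R, ∃ g : m, ∀ x, E g.1 x = E f x - E f 0 := by
    intro f
    have : ∀ x, E (f - algebraMap K R (E f 0)) x = E f x - E f 0 := by
      intro x
      rw [map_sub, Pi.sub_apply, hcst]
    refine ⟨⟨f - algebraMap K R (E f 0), ?_⟩, this⟩
    rw [hmem, this, sub_self]
  choose z hz using hz
  let ρ : X →+* Module.End K m.Cotangent :=
    { toFun := r
      map_one' := by
        apply hext
        intro f
        rw [hr]
        show _ = m.toCotangent f
        congr 1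
        apply Subtype.ext; apply hEx
        intro x
        rw [hLE, one_mul]
      map_mul' := by
        intro a b
        apply hext
        intro f
        rw [Module.End.mul_apply, hr, hr, hr]
        congr 1
        apply Subtype.ext; apply hEx
        intro x
        rw [hLE, hLE, hLE]
        congr 1
        rw [mul_comm a b, mul_assoc]
      map_zero' := by
        apply hext
        intro f
        rw [hr, LinearMap.zero_apply, ← map_zero m.toCotangent]
        congr 1
        apply Subtype.ext; apply hEx
        intro x
        rw [hLE, zero_mul]
        have h0 : E f.1 0 = 0 := f.2
        rw [h0]; simp
      map_add' := by
        intro a b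
        apply hext
        intro f
        rw [LinearMap.add_apply, hr, hr, hr, ← map_add, Ideal.toCotangent_eq]
        obtain ⟨ι, s, g, h, hh⟩ := hadd f.1
        have key : ∀ u v, E f.1 (u + v) - (E f.1 u + E f.1 v) =
            ∑ i ∈ s, (E (g i) u - E (g i) 0) * (E (h i) v - E (h i) 0) := by
          intro u v
          have h0 : E f.1 0 = 0 := f.2
          have h1 := hh u v
          have h2 := hh u 0
          have h3 := hh 0 v
          have h4 := hh 0 0
          simp only [add_zero, zero_add] at h1 h2 h3 h4
          rw [h0] at h4
          simp only [sub_mul, mul_sub, Finset.sum_sub_distrib]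
          rw [← h1, ← h2, ← h3, ← h4]
          ring
        have : (La (a + b) f.1 - (La a f.1 + La b f.1) : R) =
            ∑ i ∈ s, La a (z (g i)).1 * La b (z (h i)).1 := by
          apply hEx
          intro x
          have := key (a * x) (b * x)
          rw [← add_mul] at this
          rw [map_sum, Finset.sum_apply, map_sub, map_add, Pi.sub_apply, Pi.add_apply, hLE, hLE, hLE,
            this]
          refine Finset.sum_congr rfl fun i _ => ?_
          rw [map_mul, Pi.mul_apply, hLE, hLE, hz, hz]
        show (La (a + b) f.1 - (La a f.1 + La b f.1) : R) ∈ m ^ 2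
        rw [this]
        refine Ideal.sum_mem _ fun i _ => ?_
        rw [pow_two]
        exact Ideal.mul_mem_mul (hLa a (z (g i)).2) (hLa b (z (h i)).2) }
  have hρ : ∀ a, ρ a = r a := fun a => rfl
  clear_value ρ
  have hreg : ∀ (l : m.Cotangent →ₗ[K] K) (v : m.Cotangent), ∃ f : R, ∀ a, E f a = l (ρ a v) := by
    intro l v
    obtain ⟨f, rfl⟩ := m.toCotangent_surjective v
    obtain ⟨ι, s, g, h, hh⟩ := hmul f.1
    have : ∀ a, ρ a (m.toCotangent f) = ∑ i ∈ s, E (g i) a • m.toCotangent (z (h i)) := by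
      intro a
      rw [hρ, hr]
      have : (⟨La a f.1, hLa a f.2⟩ : m) = ∑ i ∈ s, (algebraMap K R (E (g i) a)) • z (h i) := by
        apply Subtype.ext
        apply hEx
        intro x
        rw [AddSubmonoidClass.coe_finsetSum, map_sum, Finset.sum_apply, hLE]
        have h0 : E f.1 0 = 0 := f.2
        have h1 := hh a 0
        simp only [mul_zero, h0] at h1
        have h2 : ∀ i ∈ s, E (((algebraMap K R (E (g i) a)) • z (h i) : m) : R) x =
            E (g i) a * E (h i) x - E (g i) a * E (h i) 0 := by
          intro i _
          rw [Submodule.coe_smul, smul_eq_mul, map_mul, Pi.mul_apply, hcst, hz, mul_sub]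
        rw [Finset.sum_congr rfl h2, Finset.sum_sub_distrib, ← h1, hh, sub_zero]
      rw [this, map_sum]
      refine Finset.sum_congr rfl fun i _ => ?_
      rw [map_smul, algebraMap_smul]
    refine ⟨∑ i ∈ s, l (m.toCotangent (z (h i))) • (g i), fun a => ?_⟩
    rw [this, map_sum, map_sum, Finset.sum_apply]
    refine Finset.sum_congr rfl fun i _ => ?_
    rw [map_smul, map_smul, Pi.smul_apply, smul_eq_mul, smul_eq_mul, mul_comm]
  have hfin : Module.Finite K m.Cotangent := by
    have hf : Module.Finite R m.Cotangent :=
      Module.Finite.of_surjective m.toCotangent m.toCotangent_surjective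
    obtain ⟨s, hs⟩ := hf
    refine ⟨s, ?_⟩
    rw [eq_top_iff]
    rintro v -
    have hv : v ∈ Submodule.span R (s : Set m.Cotangent) := by rw [hs]; trivial
    have hsm : ∀ (f : R) (w : m.Cotangent), f • w = E f 0 • w := by
      intro f w
      obtain ⟨w, rfl⟩ := m.toCotangent_surjective w
      rw [← algebraMap_smul R (E f 0), ← map_smul, ← map_smul, Ideal.toCotangent_eq]
      have h1 : f - algebraMap K R (E f 0) ∈ m := by
        rw [hmem, map_sub, Pi.sub_apply, hcst, sub_self]
      have h2 := Ideal.mul_mem_mul h1 w.2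
      rw [← pow_two, sub_mul] at h2
      exact h2
    induction hv using Submodule.span_induction with
    | mem x hx => exact Submodule.subset_span hx
    | zero => exact Submodule.zero_mem _
    | add x y _ _ hx hy => exact Submodule.add_mem _ hx hy
    | smul a x _ hx => rw [hsm]; exact Submodule.smul_mem _ _ hx
  have : Nontrivial m.Cotangent := by
    by_contra hV
    rw [not_nontrivial_iff_subsingleton] at hV
    have h1 : IsIdempotentElem m := (Ideal.cotangent_subsingleton_iff m).1 hV
    rcases (Ideal.isIdempotentElem_iff_eq_bot_or_top m (IsNoetherian.noetherian m)).1 h1 with h | h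
    · apply zero_ne_one (α := X)
      apply hsep
      intro f
      have h3 : (z f).1 = 0 := by
        have := h.le (z f).2
        simpa using this
      have h2 := hz f 1
      rw [h3, map_zero, Pi.zero_apply] at h2
      exact (sub_eq_zero.1 h2.symm).symm
    · have : (1 : R) ∈ m := by rw [h]; trivial
      rw [hmem, map_one] at this
      exact one_ne_zero this
  obtain ⟨ψ, l, hl⟩ := AR.char_of_rep ρ
  obtain ⟨f, hf⟩ := AR.functional_mem E ρ hreg l
  exact ⟨ψ, f, fun a => (hf a).trans (hl a).symm⟩

theorem AR.const_of_root {K B R : Type} [Field K] [IsAlgClosed K]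
    [CommRing R] [Algebra K R] (E : R →ₐ[K] (B → K)) (hE : Function.Injective E)
    [IsDomain R] (f : R) (p : K[X]) (hp : p ≠ 0) (h : ∀ a, p.eval (E f a) = 0) :
    ∃ c, ∀ a, E f a = c := by
  have h1 : aeval f p = 0 := by
    apply hE
    rw [← Polynomial.aeval_algHom_apply, map_zero]
    funext a
    have := Polynomial.aeval_algHom_apply (Pi.evalAlgHom K (fun _ : B => K) a) (E f) p
    rw [Pi.evalAlgHom_apply, Pi.evalAlgHom_apply] at this
    rw [← this, Polynomial.coe_aeval_eq_eval, h]
    rfl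
  have hi : IsIntegral K f := (isAlgebraic_iff_isIntegral).1 ⟨p, hp, h1⟩
  have hd := IsAlgClosed.degree_eq_one_of_irreducible K (minpoly.irreducible hi)
  obtain ⟨c, hc⟩ := minpoly.mem_range_of_degree_eq_one K f hd
  refine ⟨c, fun a => ?_⟩
  rw [← hc, AlgHom.commutes]
  rfl

theorem AR.main {K B R : Type} [Field K] [IsAlgClosed K] [CommRing B] [Nontrivial B]
    [CommRing R] [Algebra K R] (E : R →ₐ[K] (B → K)) (hE : Function.Injective E)
    [IsDomain R] [Algebra.FiniteType K R]
    (hadd : AR.HasComul E (· + ·)) (hmul : AR.HasComul E (· * ·))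
    (hsep : ∀ x y : B, (∀ f, E f x = E f y) → x = y)
    (hpt : ∀ χ : R →ₐ[K] K, ∃ a, ∀ f, χ f = E f a)
    (htr : Algebra.trdeg K R ≤ 1) :
    ∃ s : B ≃+* K, (∃ f : R, ∀ a, E f a = s a) ∧
      ∀ f : R, ∃ Q : K[X], ∀ a, E f a = Q.eval (s a) := by
  classical
  obtain ⟨ψ, x, hx⟩ := AR.exists_char E hE hadd hmul hsep
  have hcst : ∀ (k : K) a, E (algebraMap K R k) a = k := by
    intro k a
    rw [AlgHom.commutes]; rfl
  let ev : B → (R →ₐ[K] K) := fun a => (Pi.evalAlgHom K (fun _ : B => K) a).comp E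
  have hev : ∀ a f, ev a f = E f a := fun a f => rfl
  clear_value ev
  have hEa : ∀ (g : K[X]) a, E (aeval x g) a = g.eval (ψ a) := by
    intro g a
    rw [← hev, ← Polynomial.aeval_algHom_apply, Polynomial.coe_aeval_eq_eval, hev, hx]
  have hnc : ∀ g : K[X], (∀ a, g.eval (ψ a) = 0) → g = 0 := by
    intro g hg
    by_contra h0
    obtain ⟨c, hc⟩ := AR.const_of_root E hE x g h0 (fun a => by rw [hx, hg])
    have h1 := hc 0
    have h2 := hc 1
    rw [hx, map_zero] at h1
    rw [hx, map_one, ← h1] at h2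
    exact one_ne_zero h2
  let _ : Algebra K[X] R := (aeval x : K[X] →ₐ[K] R).toRingHom.toAlgebra
  have hal : ∀ g : K[X], algebraMap K[X] R g = aeval x g := fun g => rfl
  have : IsScalarTower K K[X] R := IsScalarTower.of_algHom (aeval x)
  have : FaithfulSMul K[X] R := by
    rw [faithfulSMul_iff_algebraMap_injective, injective_iff_map_eq_zero]
    intro g hg
    apply hnc
    intro a
    rw [← hEa, ← hal, hg, map_zero]
    rfl
  have : Algebra.IsAlgebraic K[X] R := AR.algebraic_of_trdeg htr
  have halX : algebraMap K[X] R X = x := by rw [hal, aeval_X]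
  -- injectivity
  have hinj : Function.Injective ψ := by
    rw [injective_iff_map_eq_zero]
    intro a ha
    apply hsep
    intro f
    obtain ⟨p, hp0, hp⟩ := AR.fibre (K := K) f 0
    obtain ⟨f', hf'⟩ := hmul.right a f
    obtain ⟨c, hc⟩ := AR.const_of_root E hE f' p hp0 (fun b => by
      have := hp (ev (a * b)) (by rw [halX, hev, hx, map_mul, ha, zero_mul])
      rw [hev] at this
      rw [hf']
      exact this)
    have h1 := hc 1
    have h0 := hc 0
    rw [hf'] at h1 h0
    simp only [mul_one, mul_zero] at h1 h0
    rw [h1, h0]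
  have hsurj : Function.Surjective ψ := by
    obtain ⟨h, h0, hh⟩ := AR.unit_finite (K := K) (R := R)
    intro c
    by_contra hc
    push Not at hc
    have key : ∀ a, h.eval (c + ψ a) = 0 := by
      intro a
      apply hh
      apply AR.unit_of_points (K := K)
      intro χ
      obtain ⟨b, hb⟩ := hpt χ
      rw [hb, hal, hEa]
      simp only [eval_sub, eval_X, eval_C]
      intro h2
      apply hc (b - a)
      rw [map_sub]
      linear_combination h2
    have h3 : h.comp (X + C c) = 0 := hnc _ (fun a => by
      rw [eval_comp]
      simp only [eval_add, eval_X, eval_C]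
      rw [add_comm, key])
    apply h0
    have h4 : (h.comp (X + C c)).comp (X - C c) = 0 := by rw [h3, zero_comp]
    rw [comp_assoc] at h4
    simpa using h4
  let Ψ : B ≃+* K := RingEquiv.ofBijective ψ ⟨hinj, hsurj⟩
  have hΨ : ∀ a, Ψ a = ψ a := fun a => rfl
  clear_value Ψ
  obtain ⟨p, hp⟩ := ExpChar.exists K
  have hins : ∀ r : R, ∃ n : ℕ, ∃ G : K[X], ∀ a, (E r a) ^ p ^ n = G.eval (ψ a) := by
    intro r
    obtain ⟨n, g, h, hc, hr⟩ := AR.insep p (fun χ χ' h => by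
      obtain ⟨a, ha⟩ := hpt χ
      obtain ⟨b, hb⟩ := hpt χ'
      rw [halX, ha, hb, hx, hx] at h
      have := hinj h
      subst this
      ext f
      rw [ha, hb]) r
    have hr' : ∀ a, (E r a) ^ p ^ n * h.eval (ψ a) = g.eval (ψ a) := by
      intro a
      rw [← hEa, ← hEa, ← hal, ← hal, ← hr, map_mul, map_pow]
      rfl
    have hroot : ∀ c, h.eval c ≠ 0 := by
      intro c h0
      obtain ⟨a, rfl⟩ := hsurj c
      have h1 := hr' a
      rw [h0, mul_zero] at h1
      obtain ⟨u, v, huv⟩ := hc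
      have h2 := congrArg (eval (ψ a)) huv
      simp [h0, ← h1] at h2
    have hdeg : h.degree = 0 := by
      by_contra hd
      obtain ⟨c, hc⟩ := IsAlgClosed.exists_root h hd
      exact hroot c hc
    rw [eq_C_of_degree_eq_zero hdeg] at hr' hroot
    refine ⟨n, C (h.coeff 0)⁻¹ * g, fun a => ?_⟩
    have h1 := hroot 0
    have h2 := hr' a
    simp only [eval_C] at h1 h2
    rw [eval_mul, eval_C, ← h2]
    field_simp
  obtain ⟨S, hS⟩ := (inferInstance : Algebra.FiniteType K R).out
  choose n G hG using hins
  let N := S.sup n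
  have hN : ∀ r : R, ∃ G : K[X], ∀ a, (E r a) ^ p ^ N = G.eval (ψ a) := by
    intro r
    have hr : r ∈ Algebra.adjoin K (S : Set R) := by rw [hS]; trivial
    induction hr using Algebra.adjoin_induction with
    | mem r hr =>
      obtain ⟨k, hk⟩ := Nat.exists_eq_add_of_le (Finset.le_sup (f := n) hr : n r ≤ N)
      refine ⟨G r ^ p ^ k, fun a => ?_⟩
      rw [show N = n r + k from hk, pow_add, pow_mul, hG, eval_pow]
    | algebraMap k =>
      refine ⟨C (k ^ p ^ N), fun a => ?_⟩
      rw [hcst, eval_C]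
    | add f g _ _ hf hg =>
      obtain ⟨F, hF⟩ := hf
      obtain ⟨G, hG⟩ := hg
      refine ⟨F + G, fun a => ?_⟩
      rw [map_add, Pi.add_apply, add_pow_expChar_pow, hF, hG, eval_add]
    | mul f g _ _ hf hg =>
      obtain ⟨F, hF⟩ := hf
      obtain ⟨G, hG⟩ := hg
      refine ⟨F * G, fun a => ?_⟩
      rw [map_mul, Pi.mul_apply, mul_pow, hF, hG, eval_mul]
  clear_value N
  have : PerfectRing K p := PerfectField.toPerfectRing p
  let F := iterateFrobeniusEquiv K p N
  have hF : ∀ t, F t = t ^ p ^ N := fun t => iterateFrobeniusEquiv_def _ _ _ _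
  clear_value F
  let φ : B ≃+* K := Ψ.trans F.symm
  have hφ : ∀ a, (φ a) ^ p ^ N = ψ a := by
    intro a
    rw [← hF, ← hΨ]
    simp [φ]
  clear_value φ
  have hpoly : ∀ r : R, ∃ G : K[X], ∀ a, E r a = G.eval (φ a) := by
    intro r
    obtain ⟨G, hG⟩ := hN r
    refine ⟨G.map (F.symm : K →+* K), fun a => ?_⟩
    apply F.injective
    rw [hF, hG, ← hφ, ← hF]
    have h1 := Polynomial.eval_map_apply (F : K →+* K) (φ a) (p := G.map (F.symm : K →+* K))
    rw [Polynomial.map_map] at h1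
    have h2 : (F : K →+* K).comp (F.symm : K →+* K) = RingHom.id K := by ext; simp
    rw [h2, Polynomial.map_id] at h1
    exact h1
  let W : Subalgebra K K[X] :=
    { carrier := {g | ∃ f : R, ∀ a, E f a = g.eval (φ a)}
      mul_mem' := by
        rintro g h ⟨f, hf⟩ ⟨k, hk⟩
        exact ⟨f * k, fun a => by rw [map_mul, Pi.mul_apply, hf, hk, eval_mul]⟩
      add_mem' := by
        rintro g h ⟨f, hf⟩ ⟨k, hk⟩
        exact ⟨f + k, fun a => by rw [map_add, Pi.add_apply, hf, hk, eval_add]⟩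
      algebraMap_mem' := fun k => ⟨algebraMap K R k, fun a => by
        rw [hcst, Polynomial.algebraMap_eq, eval_C]⟩ }
  have hW : ∀ g, g ∈ W ↔ ∃ f : R, ∀ a, E f a = g.eval (φ a) := fun g => Iff.rfl
  clear_value W
  obtain ⟨e, he, heW⟩ := AR.subalgebra_poly p W (by
    intro g hg α β
    rw [hW] at hg ⊢
    obtain ⟨f, hf⟩ := hg
    obtain ⟨f₁, hf₁⟩ := hadd.right (φ.symm β) f
    obtain ⟨f₂, hf₂⟩ := hmul.right (φ.symm α) f₁
    refine ⟨f₂, fun a => ?_⟩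
    rw [hf₂, hf₁, hf, eval_comp]
    simp [add_comm]) N (by
    rw [hW]
    refine ⟨x, fun a => ?_⟩
    rw [hx, eval_pow, eval_X, hφ])
  refine ⟨φ.trans (iterateFrobeniusEquiv K p e), ?_, fun f => ?_⟩
  · obtain ⟨f, hf⟩ := (hW _).1 he
    refine ⟨f, fun a => ?_⟩
    rw [hf, eval_pow, eval_X, RingEquiv.trans_apply, iterateFrobeniusEquiv_def]
  · obtain ⟨G, hG⟩ := hpoly f
    obtain ⟨Q, hQ⟩ := heW G ((hW _).2 ⟨f, hG⟩)
    refine ⟨Q, fun a => ?_⟩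
    rw [hG, hQ, eval_comp, eval_pow, eval_X, RingEquiv.trans_apply, iterateFrobeniusEquiv_def]

theorem AR.noetherian {K B R : Type} [Field K] [TopologicalSpace B] [CommRing R] [Algebra K R]
    (E : R →ₐ[K] (B → K)) [IsNoetherianRing R]
    (hb : TopologicalSpace.IsTopologicalBasis (Set.range fun f : R => {x | E f x ≠ 0})) :
    TopologicalSpace.NoetherianSpace B := by
  let ev : B → (R →+* K) := fun a => ((Pi.evalAlgHom K (fun _ : B => K) a).comp E : R →ₐ[K] K)
  let i : B → PrimeSpectrum R := fun a => ⟨RingHom.ker (ev a), RingHom.ker_isPrime _⟩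
  have hi : Topology.IsInducing i := by
    constructor
    rw [hb.eq_generateFrom, PrimeSpectrum.isTopologicalBasis_basic_opens.eq_generateFrom,
      induced_generateFrom_eq, ← Set.range_comp]
    rfl
  exact hi.noetherianSpace

theorem AR.preirred {B : Type} [TopologicalSpace B] [AddCommGroup B] [ConnectedSpace B]
    [TopologicalSpace.NoetherianSpace B] (hc : ∀ c : B, Continuous fun x => c + x) :
    PreirreducibleSpace B := by
  obtain ⟨b⟩ := (inferInstance : Nonempty B)
  obtain ⟨U, hUo, ⟨u, hu⟩, hUZ⟩ :=
    TopologicalSpace.NoetherianSpace.exists_isOpen_nonempty_subset_irreducibleComponent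
      (irreducibleComponent b) (irreducibleComponent_mem_irreducibleComponents b)
  have hU : IsPreirreducible U := isIrreducible_irreducibleComponent.2.open_subset hUo hUZ
  have hx : ∀ x : B, ∃ V : Set B, IsOpen V ∧ x ∈ V ∧ IsPreirreducible V := by
    intro x
    refine ⟨(fun y => (u - x) + y) ⁻¹' U, hUo.preimage (hc _), by simpa using hu, ?_⟩
    have := hU.image (fun y => (x - u) + y) (hc _).continuousOn
    convert this using 1
    ext y
    simp only [Set.mem_preimage, Set.mem_image]
    constructor
    · intro h
      exact ⟨_, h, by abel⟩
    · rintro ⟨z, hz, rfl⟩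
      have : u - x + (x - u + z) = z := by abel
      rwa [this]
  have hcl : ∀ V : Set B, IsOpen V → V.Nonempty → closure V = Set.univ := by
    intro V hV hne
    refine IsClopen.eq_univ ⟨isClosed_closure, ?_⟩ hne.closure
    rw [isOpen_iff_forall_mem_open]
    intro x hxV
    obtain ⟨T, hT, hxT, hTi⟩ := hx x
    refine ⟨T, fun y hy => ?_, hT, hxT⟩
    rw [mem_closure_iff]
    intro O hO hyO
    obtain ⟨z, hzT, hzV⟩ := mem_closure_iff.1 hxV T hT hxT
    obtain ⟨w, -, hw1, hw2⟩ := hTi O V hO hV ⟨y, hy, hyO⟩ ⟨z, hzT, hzV⟩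
    exact ⟨w, hw1, hw2⟩
  constructor
  rintro O V hO hV ⟨x, -, hxO⟩ ⟨y, -, hyV⟩
  have h1 : x ∈ closure V := by rw [hcl V hV ⟨y, hyV⟩]; trivial
  obtain ⟨z, h⟩ := mem_closure_iff.1 h1 O hO hxO
  exact ⟨z, trivial, h⟩

theorem AR.domain {K B R : Type} [Field K] [TopologicalSpace B] [Nonempty B] [CommRing R]
    [Algebra K R] (E : R →ₐ[K] (B → K)) (hE : Function.Injective E)
    (hb : TopologicalSpace.IsTopologicalBasis (Set.range fun f : R => {x | E f x ≠ 0}))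
    [PreirreducibleSpace B] : IsDomain R := by
  have hnt : Nontrivial R := RingHom.domain_nontrivial E.toRingHom
  have hne : ∀ f : R, f ≠ 0 → ∃ x, E f x ≠ 0 := by
    intro f hf
    by_contra h
    push Not at h
    apply hf
    apply hE
    rw [map_zero]
    exact funext h
  have : NoZeroDivisors R := by
    constructor
    intro f g hfg
    by_contra hh
    push Not at hh
    obtain ⟨x, hx⟩ := hne f hh.1
    obtain ⟨y, hy⟩ := hne g hh.2
    obtain ⟨z, -, hz1, hz2⟩ := PreirreducibleSpace.isPreirreducible_univ (X := B) _ _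
      (hb.isOpen ⟨f, rfl⟩) (hb.isOpen ⟨g, rfl⟩) ⟨x, trivial, hx⟩ ⟨y, trivial, hy⟩
    have h0 : E (f * g) z = E f z * E g z := by rw [map_mul]; rfl
    rw [hfg, map_zero] at h0
    exact mul_ne_zero hz1 hz2 h0.symm
  exact NoZeroDivisors.to_isDomain R

theorem AR.dim_le {K B R : Type} [Field K] [IsAlgClosed K] [TopologicalSpace B] [CommRing R]
    [Algebra K R] [Algebra.FiniteType K R] (E : R →ₐ[K] (B → K))
    (hb : TopologicalSpace.IsTopologicalBasis (Set.range fun f : R => {x | E f x ≠ 0}))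
    (hpt : ∀ χ : R →ₐ[K] K, ∃ a, ∀ f, χ f = E f a) :
    ringKrullDim R ≤ topologicalKrullDim B := by
  have hnull : ∀ (P : PrimeSpectrum R) (f : R), f ∉ P.asIdeal →
      ∃ a, (∀ g ∈ P.asIdeal, E g a = 0) ∧ E f a ≠ 0 := by
    intro P f hf
    by_contra hh
    push Not at hh
    apply hf
    rw [← Ideal.Quotient.eq_zero_iff_mem]
    have : Algebra.FiniteType K (R ⧸ P.asIdeal) :=
      Algebra.FiniteType.of_surjective (Ideal.Quotient.mkₐ K P.asIdeal)
        (Ideal.Quotient.mkₐ_surjective K _)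
    refine IsNilpotent.eq_zero (AR.nilp_of_points (K := K) _ fun χ => ?_)
    obtain ⟨a, ha⟩ := hpt (χ.comp (Ideal.Quotient.mkₐ K P.asIdeal))
    have h1 : χ (Ideal.Quotient.mk P.asIdeal f) = E f a := ha f
    rw [h1]
    apply hh
    intro g hg
    rw [← ha]
    show χ (Ideal.Quotient.mk P.asIdeal g) = 0
    rw [Ideal.Quotient.eq_zero_iff_mem.2 hg, map_zero]
  let Z : PrimeSpectrum R → TopologicalSpace.IrreducibleCloseds B := fun P =>
    { carrier := {x | ∀ g ∈ P.asIdeal, E g x = 0}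
      isIrreducible' := by
        constructor
        · obtain ⟨a, ha, -⟩ := hnull P 1 (fun h => P.2.ne_top ((Ideal.eq_top_iff_one _).2 h))
          exact ⟨a, ha⟩
        · rintro O V hO hV ⟨x, hx, hxO⟩ ⟨y, hy, hyV⟩
          obtain ⟨_, ⟨f, rfl⟩, hfx, hfO⟩ := hb.isOpen_iff.1 hO x hxO
          obtain ⟨_, ⟨g, rfl⟩, hgy, hgV⟩ := hb.isOpen_iff.1 hV y hyV
          have hf : f ∉ P.asIdeal := fun h => hfx (hx f h)
          have hg : g ∉ P.asIdeal := fun h => hgy (hy g h)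
          obtain ⟨a, ha, hfg⟩ := hnull P (f * g) (fun h => (P.2.mem_or_mem h).elim hf hg)
          rw [map_mul, Pi.mul_apply] at hfg
          exact ⟨a, ha, hfO (left_ne_zero_of_mul hfg), hgV (right_ne_zero_of_mul hfg)⟩
      isClosed' := by
        have : {x | ∀ g ∈ P.asIdeal, E g x = 0} = ⋂ g ∈ P.asIdeal, {x | E g x ≠ 0}ᶜ := by
          ext x
          simp
        rw [this]
        exact isClosed_biInter fun g _ => (hb.isOpen ⟨g, rfl⟩).isClosed_compl }
  have hZ : ∀ P x, x ∈ Z P ↔ ∀ g ∈ P.asIdeal, E g x = 0 := fun _ _ => Iff.rfl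
  have hle : ∀ P Q, Z Q ≤ Z P ↔ P ≤ Q := by
    intro P Q
    constructor
    · intro h f hf
      by_contra hfQ
      obtain ⟨a, ha, hfa⟩ := hnull Q f hfQ
      exact hfa ((hZ P a).1 (h ((hZ Q a).2 ha)) f hf)
    · intro h x hx
      rw [hZ] at hx ⊢
      exact fun g hg => hx g (h hg)
  have hmono : StrictMono (fun P => OrderDual.toDual (Z P)) := by
    intro P Q h
    rw [OrderDual.toDual_lt_toDual, lt_iff_le_not_ge, hle, hle]
    exact lt_iff_le_not_ge.1 h
  have := Order.krullDim_le_of_strictMono _ hmono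
  rwa [Order.krullDim_orderDual] at this

theorem AR.nontrivial_of_dim {B : Type} [TopologicalSpace B] (h : topologicalKrullDim B = 1) :
    Nontrivial B := by
  by_contra hB
  rw [not_nontrivial_iff_subsingleton] at hB
  have : Subsingleton (TopologicalSpace.IrreducibleCloseds B) := by
    constructor
    intro S T
    apply TopologicalSpace.IrreducibleCloseds.ext
    obtain ⟨x, hx⟩ := S.isIrreducible'.1
    obtain ⟨y, hy⟩ := T.isIrreducible'.1
    ext z
    exact ⟨fun _ => Subsingleton.elim y z ▸ hy, fun _ => Subsingleton.elim x z ▸ hx⟩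
  have h1 : topologicalKrullDim B ≤ 0 := Order.krullDim_nonpos_of_subsingleton
  rw [h] at h1
  exact absurd h1 (by decide)

theorem AR.split {K : Type} [Field K] (n : ℕ) (F : MvPolynomial (Fin n ⊕ Fin n) K) :
    ∃ (ι : Type) (s : Finset ι) (g h : ι → MvPolynomial (Fin n) K), ∀ x y : Fin n → K,
      MvPolynomial.eval (Sum.elim x y) F =
        ∑ i ∈ s, MvPolynomial.eval x (g i) * MvPolynomial.eval y (h i) := by
  refine ⟨_, F.support, fun d => MvPolynomial.C (F.coeff d) *
    ∏ i, MvPolynomial.X i ^ d (Sum.inl i), fun d => ∏ i, MvPolynomial.X i ^ d (Sum.inr i),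
    fun x y => ?_⟩
  rw [MvPolynomial.eval_eq']
  refine Finset.sum_congr rfl fun d _ => ?_
  rw [Fintype.prod_sum_type]
  simp [mul_assoc]

theorem AR.final (K : Type) [Field K] [IsAlgClosed K] (A : CommAlgebraicRing K)
    [ConnectedSpace A.Elt] (hdim : topologicalKrullDim A.Elt = 1) :
    ∃ φ : A.Elt ≃+* K,
      (∃ P : MvPolynomial (Fin A.n) K, ∀ x : A.Elt, φ x = MvPolynomial.eval x.1 P) ∧
      (∃ Q : Fin A.n → Polynomial K, ∀ t : K, ∀ i, (φ.symm t).1 i = (Q i).eval t) := by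
  let θ : MvPolynomial (Fin A.n) K →ₐ[K] (A.Elt → K) :=
    MvPolynomial.aeval (fun i (x : A.Elt) => x.1 i)
  have hθ : ∀ p x, θ p x = MvPolynomial.eval x.1 p := by
    intro p x
    have h1 : (Pi.evalAlgHom K (fun _ : A.Elt => K) x).comp θ = MvPolynomial.aeval x.1 := by
      ext i
      simp [θ]
    have h2 := DFunLike.congr_fun h1 p
    rw [MvPolynomial.aeval_eq_eval] at h2
    exact h2
  clear_value θ
  let R := θ.range
  let E : R →ₐ[K] (A.Elt → K) := R.val
  let q : MvPolynomial (Fin A.n) K →ₐ[K] R := θ.rangeRestrict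
  have hq : Function.Surjective q := θ.rangeRestrict_surjective
  have hEq : ∀ p x, E (q p) x = MvPolynomial.eval x.1 p := fun p x => hθ p x
  have hE : Function.Injective E := Subtype.val_injective
  clear_value q E
  have hft : Algebra.FiniteType K R := Algebra.FiniteType.of_surjective q hq
  clear_value R
  have hno : IsNoetherianRing R := Algebra.FiniteType.isNoetherianRing K R
  have hb : TopologicalSpace.IsTopologicalBasis (Set.range fun f : R => {x | E f x ≠ 0}) := by
    have hgen : (inferInstance : TopologicalSpace A.Elt) =
        TopologicalSpace.generateFrom (Set.range fun f : R => {x | E f x ≠ 0}) := by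
      show TopologicalSpace.induced (fun x : A.Elt => x.1) (affineZariski K A.n) = _
      unfold affineZariski
      rw [induced_generateFrom_eq]
      congr 1
      ext U
      constructor
      · rintro ⟨_, ⟨p, rfl⟩, rfl⟩
        refine ⟨q p, ?_⟩
        ext x
        simp only [Set.mem_ofPred_eq, Set.mem_preimage, hEq]
      · rintro ⟨f, rfl⟩
        obtain ⟨p, rfl⟩ := hq f
        refine ⟨_, ⟨p, rfl⟩, ?_⟩
        ext x
        simp only [Set.mem_ofPred_eq, Set.mem_preimage, hEq]
    refine ⟨?_, ?_, hgen⟩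
    · rintro _ ⟨f, rfl⟩ _ ⟨g, rfl⟩ x ⟨hx1, hx2⟩
      refine ⟨_, ⟨f * g, rfl⟩, ?_, ?_⟩
      · show E (f * g) x ≠ 0
        rw [map_mul]
        exact mul_ne_zero hx1 hx2
      · intro y hy
        have hy' : E (f * g) y ≠ 0 := hy
        rw [map_mul, Pi.mul_apply] at hy'
        exact ⟨left_ne_zero_of_mul hy', right_ne_zero_of_mul hy'⟩
    · rw [Set.eq_univ_iff_forall]
      intro x
      refine ⟨_, ⟨1, rfl⟩, ?_⟩
      show E 1 x ≠ 0
      rw [map_one]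
      exact one_ne_zero
  have hcom : ∀ (op : A.Elt → A.Elt → A.Elt)
      (P : Fin A.n → MvPolynomial (Fin A.n ⊕ Fin A.n) K),
      (∀ x y i, (op x y).1 i = MvPolynomial.eval (Sum.elim x.1 y.1) (P i)) →
      AR.HasComul E op := by
    intro op P hP f
    obtain ⟨p, rfl⟩ := hq f
    obtain ⟨ι, s, g, h, hgh⟩ := AR.split A.n (MvPolynomial.bind₁ P p)
    refine ⟨ι, s, fun i => q (g i), fun i => q (h i), fun x y => ?_⟩
    simp only [hEq]
    rw [← hgh]
    have : (op x y).1 = fun i => MvPolynomial.eval (Sum.elim x.1 y.1) (P i) := funext (hP x y)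
    rw [this]
    simp [← MvPolynomial.aeval_eq_eval, MvPolynomial.aeval_bind₁]
  have hadd : AR.HasComul E (· + ·) := by
    obtain ⟨P, hP⟩ := A.add_poly
    exact hcom _ P fun x y i => hP x.1 y.1 i
  have hmul : AR.HasComul E (· * ·) := by
    obtain ⟨P, hP⟩ := A.mul_poly
    exact hcom _ P fun x y i => hP x.1 y.1 i
  have hsep : ∀ x y : A.Elt, (∀ f, E f x = E f y) → x = y := by
    intro x y h
    apply Subtype.ext
    funext i
    have := h (q (MvPolynomial.X i))
    simpa [hEq] using this
  have hpt : ∀ χ : R →ₐ[K] K, ∃ a, ∀ f, χ f = E f a := by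
    intro χ
    let v : Fin A.n → K := fun i => χ (q (MvPolynomial.X i))
    have hv : ∀ p, χ (q p) = MvPolynomial.eval v p := by
      intro p
      have h1 : χ.comp q = MvPolynomial.aeval v := by
        ext i
        simp [v]
      have h2 := DFunLike.congr_fun h1 p
      rw [MvPolynomial.aeval_eq_eval] at h2
      exact h2
    have hmem : v ∈ A.carrier := by
      obtain ⟨S, hS⟩ := A.carrier_closed
      rw [hS]
      intro p hp
      rw [← hv]
      have : q p = 0 := by
        apply hE
        funext x
        rw [hEq, map_zero]
        have hx : x.1 ∈ {x | ∀ p ∈ S, MvPolynomial.eval x p = 0} := hS.le x.2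
        exact hx p hp
      rw [this, map_zero]
    refine ⟨⟨v, hmem⟩, fun f => ?_⟩
    obtain ⟨p, rfl⟩ := hq f
    exact (hv p).trans (hEq p ⟨v, hmem⟩).symm
  have hcont : ∀ c : A.Elt, Continuous fun x => c + x := by
    intro c
    rw [hb.continuous_iff]
    rintro _ ⟨f, rfl⟩
    obtain ⟨f', hf'⟩ := hadd.right c f
    have : (fun x => c + x) ⁻¹' {x | E f x ≠ 0} = {x | E f' x ≠ 0} := by
      ext x
      simp only [Set.mem_preimage, Set.mem_ofPred_eq, hf']
    rw [this]
    exact hb.isOpen ⟨f', rfl⟩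
  have hns : TopologicalSpace.NoetherianSpace A.Elt := AR.noetherian E hb
  have hpre : PreirreducibleSpace A.Elt := AR.preirred hcont
  have hdom : IsDomain R := AR.domain E hE hb
  have hnt : Nontrivial A.Elt := AR.nontrivial_of_dim hdim
  have htr : Algebra.trdeg K R ≤ 1 := by
    by_contra h
    have h1 := AR.two_le_of_trdeg (not_le.1 h)
    have h2 := AR.dim_le E hb hpt
    rw [hdim] at h2
    exact absurd (h1.trans h2) (by decide)
  obtain ⟨s, ⟨f, hf⟩, hs⟩ := AR.main E hE hadd hmul hsep hpt htr
  refine ⟨s, ?_, ?_⟩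
  · obtain ⟨p, rfl⟩ := hq f
    exact ⟨p, fun x => by rw [← hf, hEq]⟩
  · choose Q hQ using fun i => hs (q (MvPolynomial.X i))
    refine ⟨Q, fun t i => ?_⟩
    have := hQ i (s.symm t)
    rw [hEq, MvPolynomial.eval_X, RingEquiv.apply_symm_apply] at this
    exact this

end

/-- A one-dimensional connected commutative algebraic ring over an
algebraically closed field `K` is isomorphic, as an algebraic ring, to `(K, +, ⬝)`:
there is a ring isomorphism which is regular in both directions. -/
theorem stmt_14 (K : Type) [Field K] [IsAlgClosed K] (A : CommAlgebraicRing K)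
    [ConnectedSpace A.Elt] (hdim : topologicalKrullDim A.Elt = 1) :
    ∃ φ : A.Elt ≃+* K,
      (∃ P : MvPolynomial (Fin A.n) K, ∀ x : A.Elt, φ x = MvPolynomial.eval x.1 P) ∧
      (∃ Q : Fin A.n → Polynomial K, ∀ t : K, ∀ i, (φ.symm t).1 i = (Q i).eval t) :=
  AR.final K A hdim
end
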